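/- Let A = A_{n,(n_0,…,n_r)}^{(l_0,…,l_r)} be a linear Nakayama algebra with almost separate relations, and let A' be the quotient of kA_n by the ideal generated only by those relation paths whose length l_i is at least 3 (so A' = kA_n if all l_i = 2). Then A and A' are derived equivalent; in other words, relations of length 2 have no effect on the derived equivalence class of a linear Nakayama algebra with almost separate relations. -/

import Mathlib

open CategoryTheory

/-- A finite quiver: a finite vertex type, an arrow type, and source/target maps. -/
structure PreQuiver where
  V : Type
  A : Type
  [fintV : Fintype V]
  s : A → V
  t : A → V

attribute [instance] PreQuiver.fintV

/-- The defining relations presenting the path algebra of the quiver `Q` over `k`, together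
with the zero relations given by the paths (lists of composable arrows) in `R`.  The
generators are the trivial paths `Sum.inl v` (one for each vertex) and the arrows
`Sum.inr a`; multiplication of generators corresponds to concatenation of paths, so that the
resulting algebra has as a basis the paths of `Q` (not passing through a relation of `R`). -/
inductive PathAlgRel (k : Type) [Field k] (Q : PreQuiver) (R : Set (List Q.A)) :
    FreeAlgebra k (Q.V ⊕ Q.A) → FreeAlgebra k (Q.V ⊕ Q.A) → Prop
  | idem (v : Q.V) :
      PathAlgRel k Q R (FreeAlgebra.ι k (Sum.inl v) * FreeAlgebra.ι k (Sum.inl v))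
        (FreeAlgebra.ι k (Sum.inl v))
  | orth (v w : Q.V) (h : v ≠ w) :
      PathAlgRel k Q R (FreeAlgebra.ι k (Sum.inl v) * FreeAlgebra.ι k (Sum.inl w)) 0
  | unit :
      PathAlgRel k Q R (∑ v : Q.V, FreeAlgebra.ι k (Sum.inl v)) 1
  | source (a : Q.A) :
      PathAlgRel k Q R (FreeAlgebra.ι k (Sum.inl (Q.s a)) * FreeAlgebra.ι k (Sum.inr a))
        (FreeAlgebra.ι k (Sum.inr a))
  | target (a : Q.A) :
      PathAlgRel k Q R (FreeAlgebra.ι k (Sum.inr a) * FreeAlgebra.ι k (Sum.inl (Q.t a)))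
        (FreeAlgebra.ι k (Sum.inr a))
  | zeroRel (p : List Q.A) (hp : p ∈ R) :
      PathAlgRel k Q R ((p.map fun a => FreeAlgebra.ι k (Sum.inr a)).prod) 0

/-- The path algebra of the quiver `Q` over the field `k`, modulo the two-sided ideal
generated by the zero relations in `R`. -/
abbrev PathAlgebraRel (k : Type) [Field k] (Q : PreQuiver) (R : Set (List Q.A)) : Type :=
  RingQuot (PathAlgRel k Q R)

/-- The path algebra of the quiver `Q` over the field `k`. -/
abbrev PathAlgebra (k : Type) [Field k] (Q : PreQuiver) : Type :=
  PathAlgebraRel k Q ∅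

noncomputable instance (C : Type*) [Category C] [Abelian C] : HasDerivedCategory C :=
  HasDerivedCategory.standard C

/-- Two `k`-algebras are *derived equivalent* if there is a triangulated equivalence between
the derived categories of their categories of right modules (i.e. of left modules over the
opposite rings). -/
def DerivedEquivalent (k : Type) [Field k] (A : Type) [Ring A] [Algebra k A]
    (B : Type) [Ring B] [Algebra k B] : Prop :=
  ∃ (F : DerivedCategory (ModuleCat.{0} Aᵐᵒᵖ) ⥤ DerivedCategory (ModuleCat.{0} Bᵐᵒᵖ))
    (c : F.CommShift ℤ), haveI := c; (F.IsTriangulated ∧ F.IsEquivalence)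

/-- The linearly ordered quiver `A_n` of Dynkin type `A`, with vertices `1, …, n`
(realized as `Fin n`) and an arrow from each vertex to the next one. -/
def linQuiver (n : ℕ) : PreQuiver where
  V := Fin n
  A := Fin (n - 1)
  s := fun a => ⟨a.1, by have := a.2; omega⟩
  t := fun a => ⟨a.1 + 1, by have := a.2; omega⟩

/-- The path of length `l` in the quiver `A_n` starting at the (1-indexed) vertex `v`. -/
def linPath (n : ℕ) (v l : ℕ) : List (linQuiver n).A :=
  (List.range l).filterMap fun j =>
    if h : v - 1 + j < n - 1 then some ⟨v - 1 + j, h⟩ else none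

/-- The linear Nakayama algebra `A_{n,(n_0,…,n_{t-1})}^{(l_0,…,l_{t-1})}`: the quotient of
the path algebra of `A_n` over `k` by the two-sided ideal generated, for each `i`, by the
path of length `ls i` starting at the vertex `ns i`. -/
abbrev NakayamaAlgebra (k : Type) [Field k] (n t : ℕ) (ns ls : Fin t → ℕ) : Type :=
  PathAlgebraRel k (linQuiver n) {p | ∃ i : Fin t, p = linPath n (ns i) (ls i)}

/-- The hypotheses on the data of a linear Nakayama algebra
`A_{n,(n_0,…,n_{t-1})}^{(l_0,…,l_{t-1})}` with almost separate relations: each relation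
starts at a vertex `ns i ≥ 1` and has length `ls i ≥ 2`, the start vertices are strictly
increasing, the end vertices `ns i + ls i` are strictly increasing and at most `n`, and the
overlap of two relations is at most one arrow (`ns j ≥ ns i + ls i - 1` for `i < j`). -/
structure IsASNakayama (n t : ℕ) (ns ls : Fin t → ℕ) : Prop where
  one_le : ∀ i, 1 ≤ ns i
  two_le : ∀ i, 2 ≤ ls i
  start_lt : ∀ i j, i < j → ns i < ns j
  end_lt : ∀ i j, i < j → ns i + ls i < ns j + ls j
  end_le : ∀ i, ns i + ls i ≤ n
  almost_separate : ∀ i j, i < j → ns i + ls i ≤ ns j + 1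


section
namespace NakDer
open CategoryTheory Category Limits Pretriangulated

section AbstractLoc
variable {K H D : Type*} [Category K] [Category H] [Category D]
  [HasZeroObject K] [HasShift K ℤ] [Preadditive K]
  [∀ (n : ℤ), (shiftFunctor K n).Additive] [Pretriangulated K]
  [HasZeroObject H] [HasShift H ℤ] [Preadditive H]
  [∀ (n : ℤ), (shiftFunctor H n).Additive] [Pretriangulated H] [IsTriangulated H]
  (Φ : K ⥤ H) [Φ.CommShift ℤ] [Φ.IsTriangulated] [Φ.Full] [Φ.Faithful]
  (B : ObjectProperty H) [B.IsTriangulated] [B.IsClosedUnderIsomorphisms]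

lemma trW_inverseImage_iff {X Y : K} (f : X ⟶ Y) :
    (B.inverseImage Φ).trW f ↔ B.trW (Φ.map f) := by
  obtain ⟨Z, g, h, hT⟩ := distinguished_cocone_triangle f
  exact ((B.inverseImage Φ).trW_iff_of_distinguished _ hT).trans
    (B.trW_iff_of_distinguished _ (Φ.map_distinguished _ hT)).symm

lemma isLocalization_aux (L : H ⥤ D) [L.IsLocalization B.trW]
    [(Φ.essImage.triangulatedLocalizerMorphism B).IsLocalizedFullyFaithful]
    (hs : ∀ X : H, ∃ Y : K, Nonempty (L.obj (Φ.obj Y) ≅ L.obj X)) :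
    (Φ ⋙ L).IsLocalization (B.inverseImage Φ).trW := by
  have : (Φ.essImage.ι ⋙ L).EssSurj := ⟨fun d => by
    have := Localization.essSurj L B.trW
    obtain ⟨Y, ⟨e⟩⟩ := hs (L.objPreimage d)
    exact ⟨⟨Φ.obj Y, ⟨Y, ⟨Iso.refl _⟩⟩⟩, ⟨e ≪≫ L.objObjPreimageIso d⟩⟩⟩
  have h1 : (Φ.essImage.ι ⋙ L).IsLocalization (B.inverseImage Φ.essImage.ι).trW :=
    (Φ.essImage.triangulatedLocalizerMorphism B).isLocalization_of_isLocalizedFullyFaithful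
      (L₂ := L) (L₁ := Φ.essImage.ι ⋙ L) (F := 𝟭 D) (Functor.rightUnitor _).symm
  have : Φ.toEssImage.IsEquivalence := inferInstance
  refine Functor.IsLocalization.of_equivalence_source (Φ.essImage.ι ⋙ L)
    (B.inverseImage Φ.essImage.ι).trW (Φ ⋙ L) (B.inverseImage Φ).trW
    Φ.toEssImage.asEquivalence.symm ?_ ?_ ?_
  · intro X Y f hf
    refine MorphismProperty.le_isoClosure _ _ ?_
    rw [trW_inverseImage_iff]
    rw [trW_inverseImage_iff] at hf
    refine (MorphismProperty.arrow_mk_iso_iff B.trW ?_).1 hf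
    let e : Φ.essImage.ι ≅ Φ.toEssImage.asEquivalence.inverse ⋙ Φ :=
      (Functor.leftUnitor _).symm ≪≫
      Functor.isoWhiskerRight Φ.toEssImage.asEquivalence.counitIso.symm _ ≪≫
      Functor.associator _ _ _ ≪≫ Functor.isoWhiskerLeft _ Φ.toEssImageCompι
    exact Arrow.isoOfNatIso e (Arrow.mk f)
  · intro X Y f hf
    rw [trW_inverseImage_iff] at hf
    exact Localization.inverts L B.trW _ hf
  · exact (Functor.associator _ _ _).symm ≪≫ Functor.isoWhiskerRight
      (Functor.isoWhiskerLeft _ Φ.toEssImageCompι.symm ≪≫ (Functor.associator _ _ _).symm ≪≫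
        Functor.isoWhiskerRight Φ.toEssImage.asEquivalence.counitIso _ ≪≫
        Functor.leftUnitor _) L

lemma isLocalization_left (L : H ⥤ D) [L.IsLocalization B.trW]
    (hs : ∀ X : H, ∃ (Y : K) (f : Φ.obj Y ⟶ X), B.trW f) :
    (Φ ⋙ L).IsLocalization (B.inverseImage Φ).trW := by
  have : Φ.essImage.IsVerdierLeftLocalizing B := by
    rw [ObjectProperty.isVerdierLeftLocalizing_iff]
    intro X Y s hY hs'
    obtain ⟨Z, f, hf⟩ := hs X
    refine ⟨Φ.obj Z, f ≫ s, f, ⟨Z, ⟨Iso.refl _⟩⟩, ?_, rfl⟩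
    have h1 : B.trW (f ≫ s) := B.trW.comp_mem _ _ hf hs'
    obtain ⟨U, a, b, hT⟩ := distinguished_cocone_triangle (f ≫ s)
    rw [ObjectProperty.trW_iff]
    exact ⟨U, a, b, hT, Φ.essImage.ext_of_isTriangulatedClosed₃ _ hT ⟨Z, ⟨Iso.refl _⟩⟩ hY,
      (B.trW_iff_of_distinguished _ hT).1 h1⟩
  refine isLocalization_aux Φ B L fun X => ?_
  obtain ⟨Y, f, hf⟩ := hs X
  have := Localization.inverts L B.trW f hf
  exact ⟨Y, ⟨asIso (L.map f)⟩⟩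

lemma isLocalization_right (L : H ⥤ D) [L.IsLocalization B.trW]
    (hs : ∀ X : H, ∃ (Y : K) (f : X ⟶ Φ.obj Y), B.trW f) :
    (Φ ⋙ L).IsLocalization (B.inverseImage Φ).trW := by
  have : Φ.essImage.IsVerdierRightLocalizing B := by
    rw [ObjectProperty.isVerdierRightLocalizing_iff]
    intro X Y s hY hs'
    obtain ⟨Z, f, hf⟩ := hs Y
    refine ⟨Φ.obj Z, s ≫ f, f, ⟨Z, ⟨Iso.refl _⟩⟩, ?_, rfl⟩
    have h1 : B.trW (s ≫ f) := B.trW.comp_mem _ _ hs' hf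
    obtain ⟨U, a, b, hT⟩ := distinguished_cocone_triangle (s ≫ f)
    rw [ObjectProperty.trW_iff]
    exact ⟨U, a, b, hT, Φ.essImage.ext_of_isTriangulatedClosed₃ _ hT hY ⟨Z, ⟨Iso.refl _⟩⟩,
      (B.trW_iff_of_distinguished _ hT).1 h1⟩
  refine isLocalization_aux Φ B L fun X => ?_
  obtain ⟨Y, f, hf⟩ := hs X
  have := Localization.inverts L B.trW f hf
  exact ⟨Y, ⟨(asIso (L.map f)).symm⟩⟩

end AbstractLoc

section Uniq
variable {K D₁ D₂ : Type*} [Category K] [Category D₁] [Category D₂]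
  [HasZeroObject K] [HasShift K ℤ] [Preadditive K]
  [∀ (n : ℤ), (shiftFunctor K n).Additive] [Pretriangulated K]
  [HasZeroObject D₁] [HasShift D₁ ℤ] [Preadditive D₁]
  [∀ (n : ℤ), (shiftFunctor D₁ n).Additive] [Pretriangulated D₁]
  [HasZeroObject D₂] [HasShift D₂ ℤ] [Preadditive D₂]
  [∀ (n : ℤ), (shiftFunctor D₂ n).Additive] [Pretriangulated D₂]

lemma exists_equiv_of_localizations (W : MorphismProperty K) [W.HasLeftCalculusOfFractions]
    (L₁ : K ⥤ D₁) (L₂ : K ⥤ D₂) [L₁.CommShift ℤ] [L₂.CommShift ℤ]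
    [L₁.IsTriangulated] [L₂.IsTriangulated]
    [L₁.IsLocalization W] [L₂.IsLocalization W] :
    ∃ (F : D₁ ⥤ D₂) (c : F.CommShift ℤ), haveI := c; (F.IsTriangulated ∧ F.IsEquivalence) := by
  let F := (Localization.uniq L₁ L₂ W).functor
  let e : L₁ ⋙ F ≅ L₂ := Localization.compUniqFunctor L₁ L₂ W
  let : Localization.Lifting L₁ W L₂ F := ⟨e⟩
  let c : F.CommShift ℤ := Functor.commShiftOfLocalization L₁ W ℤ L₂ F
  refine ⟨F, c, ?_, inferInstance⟩
  have : NatTrans.CommShift e.hom ℤ := NatTrans.commShift_iso_hom_of_localization L₁ W ℤ L₂ F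
  have := Localization.essSurj_mapArrow L₁ W
  exact Functor.isTriangulated_of_precomp_iso e
end Uniq
end NakDer
end

section
namespace NakDer
open CategoryTheory Category Limits Pretriangulated
open scoped ZeroObject
set_option linter.unusedSectionVars false

section Resol
variable {K H : Type*} [Category K] [Category H]
  [HasZeroObject K] [HasShift K ℤ] [Preadditive K]
  [∀ (n : ℤ), (shiftFunctor K n).Additive] [Pretriangulated K]
  [HasZeroObject H] [HasShift H ℤ] [Preadditive H]
  [∀ (n : ℤ), (shiftFunctor H n).Additive] [Pretriangulated H] [IsTriangulated H]
  (Φ : K ⥤ H) [Φ.CommShift ℤ] [Φ.IsTriangulated] [Φ.Full]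
  (B : ObjectProperty H) [B.IsTriangulated] [B.IsClosedUnderIsomorphisms]

/-- `X` has a left resolution by an object coming from `K`. -/
def HasLeft (X : H) : Prop := ∃ (Y : K) (f : Φ.obj Y ⟶ X), B.trW f

/-- `X` has a right resolution by an object coming from `K`. -/
def HasRight (X : H) : Prop := ∃ (Y : K) (f : X ⟶ Φ.obj Y), B.trW f

lemma HasLeft.cone {X₁ X₃ : H} {Y₂ : K} (u : X₁ ⟶ Φ.obj Y₂) (v : Φ.obj Y₂ ⟶ X₃)
    (w : X₃ ⟶ X₁⟦(1 : ℤ)⟧) (hT : Triangle.mk u v w ∈ distTriang H) (h : HasLeft Φ B X₁) :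
    HasLeft Φ B X₃ := by
  obtain ⟨Y₁, q, hq⟩ := h
  obtain ⟨g, hg⟩ := Φ.map_surjective (q ≫ u)
  obtain ⟨Z, a, b, hZ⟩ := distinguished_cocone_triangle g
  obtain ⟨C, c, d, hC⟩ := distinguished_cocone_triangle q
  have o := Triangulated.someOctahedron (u₁₂ := q) (u₂₃ := u) (u₁₃ := Φ.map g) hg.symm hC hT
    (Φ.map_distinguished _ hZ)
  exact ⟨Z, o.m₃, (B.trW_iff_of_distinguished' _ o.mem).2
    ((B.trW_iff_of_distinguished _ hC).1 hq)⟩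

lemma HasRight.of_shift {X : H} (h : HasRight Φ B (X⟦(1 : ℤ)⟧)) : HasRight Φ B X := by
  obtain ⟨Y, f, hf⟩ := h
  refine ⟨Y⟦(-1 : ℤ)⟧, (shiftShiftNeg X (1 : ℤ)).inv ≫ f⟦(-1 : ℤ)⟧' ≫
    (Φ.commShiftIso (-1 : ℤ)).inv.app Y, ?_⟩
  have h1 : B.trW (f⟦(-1 : ℤ)⟧') :=
    (MorphismProperty.IsCompatibleWithShift.iff B.trW f (-1 : ℤ)).2 hf
  refine (MorphismProperty.arrow_mk_iso_iff B.trW ?_).1 h1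
  exact Arrow.isoMk (shiftShiftNeg X (1 : ℤ)) ((Φ.commShiftIso (-1 : ℤ)).symm.app Y)
    ((shiftShiftNeg X (1 : ℤ)).hom_inv_id_assoc _)

lemma HasRight.fiber {X₁ X₃ : H} {Y₂ : K} (u : X₁ ⟶ Φ.obj Y₂) (v : Φ.obj Y₂ ⟶ X₃)
    (w : X₃ ⟶ X₁⟦(1 : ℤ)⟧) (hT : Triangle.mk u v w ∈ distTriang H) (h : HasRight Φ B X₃) :
    HasRight Φ B X₁ := by
  obtain ⟨Y₃, q, hq⟩ := h
  obtain ⟨g, hg⟩ := Φ.map_surjective (v ≫ q)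
  obtain ⟨Z, a, b, hZ⟩ := distinguished_cocone_triangle g
  obtain ⟨C, c, d, hC⟩ := distinguished_cocone_triangle q
  have o := Triangulated.someOctahedron (u₁₂ := v) (u₂₃ := q) (u₁₃ := Φ.map g) hg.symm
    (rot_of_distTriang _ hT) hC (Φ.map_distinguished _ hZ)
  exact HasRight.of_shift _ _ ⟨Z, o.m₁, (B.trW_iff_of_distinguished _ o.mem).2
    ((B.trW_iff_of_distinguished _ hC).1 hq)⟩

lemma HasLeft.of_trW {X X' : H} (f : X ⟶ X') (hf : B.trW f) (h : HasLeft Φ B X) :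
    HasLeft Φ B X' := by
  obtain ⟨Y, g, hg⟩ := h
  exact ⟨Y, g ≫ f, B.trW.comp_mem _ _ hg hf⟩

lemma HasRight.of_trW {X X' : H} (f : X ⟶ X') (hf : B.trW f) (h : HasRight Φ B X') :
    HasRight Φ B X := by
  obtain ⟨Y, g, hg⟩ := h
  exact ⟨Y, f ≫ g, B.trW.comp_mem _ _ hf hg⟩

end Resol

section Cplx
variable {E C : Type*} [Category E] [Category C] [Preadditive E] [HasZeroObject E]
  [HasBinaryBiproducts E] [Abelian C] (F : E ⥤ C) [F.Additive] [F.Full] [F.Faithful]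

/-- shorthand -/
abbrev HL (X : CochainComplex C ℤ) : Prop :=
  HasLeft (F.mapHomotopyCategory (ComplexShape.up ℤ)) (HomotopyCategory.subcategoryAcyclic C)
    ((HomotopyCategory.quotient C _).obj X)

/-- shorthand -/
abbrev HR (X : CochainComplex C ℤ) : Prop :=
  HasRight (F.mapHomotopyCategory (ComplexShape.up ℤ)) (HomotopyCategory.subcategoryAcyclic C)
    ((HomotopyCategory.quotient C _).obj X)

lemma trW_of_quasiIso {X Y : CochainComplex C ℤ} (f : X ⟶ Y) (hf : QuasiIso f) :
    (HomotopyCategory.subcategoryAcyclic C).trW ((HomotopyCategory.quotient C _).map f) := by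
  rw [← HomotopyCategory.quasiIso_eq_trW_subcategoryAcyclic,
    HomotopyCategory.quotient_map_mem_quasiIso_iff]
  exact hf

lemma HL_of_shortExact {X₁ X₃ : CochainComplex C ℤ} (Y : CochainComplex E ℤ)
    (f : X₁ ⟶ (F.mapHomologicalComplex _).obj Y) (g : (F.mapHomologicalComplex _).obj Y ⟶ X₃)
    (w : f ≫ g = 0) (hS : (ShortComplex.mk f g w).ShortExact)
    (h : HL F X₁) : HL F X₃ := by
  have := CochainComplex.mappingCone.quasiIso_descShortComplex hS
  refine HasLeft.of_trW _ _ _ (trW_of_quasiIso _ this) ?_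
  have hT : CochainComplex.mappingCone.triangleh f ∈ distTriang _ :=
    HomotopyCategory.mappingCone_triangleh_distinguished f
  exact HasLeft.cone (F.mapHomotopyCategory (ComplexShape.up ℤ))
    (HomotopyCategory.subcategoryAcyclic C)
    (Y₂ := (HomotopyCategory.quotient E _).obj Y) _ _ _ hT h

lemma HR_of_shortExact {X₁ X₃ : CochainComplex C ℤ} (Y : CochainComplex E ℤ)
    (f : X₁ ⟶ (F.mapHomologicalComplex _).obj Y) (g : (F.mapHomologicalComplex _).obj Y ⟶ X₃)
    (w : f ≫ g = 0) (hS : (ShortComplex.mk f g w).ShortExact)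
    (h : HR F X₃) : HR F X₁ := by
  have := CochainComplex.mappingCone.quasiIso_descShortComplex hS
  have h' := HasRight.of_trW _ _ _ (trW_of_quasiIso _ this) h
  have hT : CochainComplex.mappingCone.triangleh f ∈ distTriang _ :=
    HomotopyCategory.mappingCone_triangleh_distinguished f
  exact HasRight.fiber (F.mapHomotopyCategory (ComplexShape.up ℤ))
    (HomotopyCategory.subcategoryAcyclic C)
    (Y₂ := (HomotopyCategory.quotient E _).obj Y) _ _ _ hT h'

lemma isZero_complex {X : CochainComplex C ℤ} (h : ∀ n, IsZero (X.X n)) : IsZero X := by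
  rw [IsZero.iff_id_eq_zero]
  ext n
  exact (h n).eq_of_src _ _

lemma trW_of_isZero {X Y : CochainComplex C ℤ} (f : X ⟶ Y) (hX : IsZero X) (hY : IsZero Y) :
    (HomotopyCategory.subcategoryAcyclic C).trW ((HomotopyCategory.quotient C _).map f) := by
  have : IsIso f := ⟨0, hX.eq_of_src _ _, hY.eq_of_src _ _⟩
  exact trW_of_quasiIso _ inferInstance

lemma isZero_map_zero : IsZero ((F.mapHomologicalComplex (ComplexShape.up ℤ)).obj 0) :=
  (F.mapHomologicalComplex (ComplexShape.up ℤ)).map_isZero (isZero_zero _)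

/-- Left resolutions exist, by dévissage. -/
lemma HL_all (Fr : C ⥤ E) [Fr.Additive] (e : Fr ⋙ F ⟶ 𝟭 C) [∀ M, Epi (e.app M)]
    (P : ℕ → C → Prop) (m : ℕ) (h0 : ∀ M, P 0 M) (hm : ∀ M, P m M → IsZero M)
    (hs : ∀ (c : ℕ) (N M : C) (i : N ⟶ F.obj (Fr.obj M)) [Mono i], i ≫ e.app M = 0 → P c M →
      P (c + 1) N) (X : CochainComplex C ℤ) : HL F X := by
  suffices H : ∀ (d c : ℕ) (X : CochainComplex C ℤ), c + d = m → (∀ n, P c (X.X n)) → HL F X from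
    H m 0 X (by simp) (fun n => h0 _)
  intro d
  induction d with
  | zero =>
    intro c X hc hX
    obtain rfl : c = m := by simpa using hc
    have hz := isZero_complex (fun n => hm _ (hX n))
    exact ⟨(HomotopyCategory.quotient E _).obj 0, (HomotopyCategory.quotient C _).map
      (0 : (F.mapHomologicalComplex (ComplexShape.up ℤ)).obj 0 ⟶ X),
      trW_of_isZero _ (isZero_map_zero F) hz⟩
  | succ d ih =>
    intro c X hc hX
    let Y : CochainComplex E ℤ := (Fr.mapHomologicalComplex _).obj X
    let ε : (F.mapHomologicalComplex _).obj Y ⟶ X :=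
      { f := fun n => e.app (X.X n)
        comm' := fun i j _ => (e.naturality (X.d i j)).symm }
    have : Epi ε := by
      have : ∀ n, Epi (ε.f n) := fun n => inferInstanceAs (Epi (e.app (X.X n)))
      exact HomologicalComplex.epi_of_epi_f _ this
    have hS : (ShortComplex.mk (kernel.ι ε) ε (kernel.condition ε)).ShortExact :=
      { exact := ShortComplex.exact_kernel ε
        mono_f := inferInstance
        epi_g := inferInstance }
    refine HL_of_shortExact F Y _ _ _ hS (ih (c + 1) _ (by omega) fun n => ?_)
    have : Mono ((kernel.ι ε).f n) :=
      inferInstanceAs (Mono ((HomologicalComplex.eval C _ n).map (kernel.ι ε)))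
    refine @hs c _ (X.X n) ((kernel.ι ε).f n) this ?_ (hX n)
    have := congrArg (fun f => f.f n) (kernel.condition ε)
    exact this

/-- Right resolutions exist, by dévissage. -/
lemma HR_all (Fr : C ⥤ E) [Fr.Additive] (e : 𝟭 C ⟶ Fr ⋙ F) [∀ M, Mono (e.app M)]
    (P : ℕ → C → Prop) (m : ℕ) (h0 : ∀ M, P 0 M) (hm : ∀ M, P m M → IsZero M)
    (hs : ∀ (c : ℕ) (N M : C) (i : F.obj (Fr.obj M) ⟶ N) [Epi i], e.app M ≫ i = 0 → P c M →
      P (c + 1) N) (X : CochainComplex C ℤ) : HR F X := by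
  suffices H : ∀ (d c : ℕ) (X : CochainComplex C ℤ), c + d = m → (∀ n, P c (X.X n)) → HR F X from
    H m 0 X (by simp) (fun n => h0 _)
  intro d
  induction d with
  | zero =>
    intro c X hc hX
    obtain rfl : c = m := by simpa using hc
    have hz := isZero_complex (fun n => hm _ (hX n))
    exact ⟨(HomotopyCategory.quotient E _).obj 0, (HomotopyCategory.quotient C _).map
      (0 : X ⟶ (F.mapHomologicalComplex (ComplexShape.up ℤ)).obj 0),
      trW_of_isZero _ hz (isZero_map_zero F)⟩
  | succ d ih =>
    intro c X hc hX
    let Y : CochainComplex E ℤ := (Fr.mapHomologicalComplex _).obj X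
    let ε : X ⟶ (F.mapHomologicalComplex _).obj Y :=
      { f := fun n => e.app (X.X n)
        comm' := fun i j _ => (e.naturality (X.d i j)).symm }
    have : Mono ε := by
      have : ∀ n, Mono (ε.f n) := fun n => inferInstanceAs (Mono (e.app (X.X n)))
      exact HomologicalComplex.mono_of_mono_f _ this
    have hS : (ShortComplex.mk ε (cokernel.π ε) (cokernel.condition ε)).ShortExact :=
      { exact := ShortComplex.exact_cokernel ε
        mono_f := inferInstance
        epi_g := inferInstance }
    refine HR_of_shortExact F Y _ _ _ hS (ih (c + 1) _ (by omega) fun n => ?_)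
    have : Epi ((cokernel.π ε).f n) :=
      inferInstanceAs (Epi ((HomologicalComplex.eval C _ n).map (cokernel.π ε)))
    refine @hs c _ (X.X n) ((cokernel.π ε).f n) this ?_ (hX n)
    have := congrArg (fun f => f.f n) (cokernel.condition ε)
    exact this

variable {C₂ : Type*} [Category C₂] [Abelian C₂] (F₂ : E ⥤ C₂) [F₂.Additive] [F₂.Full]
  [F₂.Faithful] [HasDerivedCategory C] [HasDerivedCategory C₂]

theorem exists_derived_equivalence (h1 : ∀ X, HL F X) (h2 : ∀ X, HR F₂ X)
    (h3 : ∀ Y : CochainComplex E ℤ, ((F.mapHomologicalComplex _).obj Y).Acyclic ↔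
      ((F₂.mapHomologicalComplex _).obj Y).Acyclic) :
    ∃ (G : DerivedCategory C ⥤ DerivedCategory C₂) (c : G.CommShift ℤ),
      haveI := c; (G.IsTriangulated ∧ G.IsEquivalence) := by
  let Φ₁ := F.mapHomotopyCategory (ComplexShape.up ℤ)
  let Φ₂ := F₂.mapHomotopyCategory (ComplexShape.up ℤ)
  let B₁ := HomotopyCategory.subcategoryAcyclic C
  let B₂ := HomotopyCategory.subcategoryAcyclic C₂
  have hB : B₁.inverseImage Φ₁ = B₂.inverseImage Φ₂ := by
    ext Y
    obtain ⟨Y, rfl⟩ := HomotopyCategory.quotient_obj_surjective Y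
    have := h3 Y
    rw [← HomotopyCategory.quotient_obj_mem_subcategoryAcyclic_iff_acyclic,
      ← HomotopyCategory.quotient_obj_mem_subcategoryAcyclic_iff_acyclic] at this
    exact this
  have l1 : (Φ₁ ⋙ DerivedCategory.Qh).IsLocalization (B₁.inverseImage Φ₁).trW :=
    isLocalization_left Φ₁ B₁ _ (fun X => by
      obtain ⟨X, rfl⟩ := HomotopyCategory.quotient_obj_surjective X
      exact h1 X)
  have l2 : (Φ₂ ⋙ DerivedCategory.Qh).IsLocalization (B₁.inverseImage Φ₁).trW := by
    rw [hB]
    exact isLocalization_right Φ₂ B₂ _ (fun X => by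
      obtain ⟨X, rfl⟩ := HomotopyCategory.quotient_obj_surjective X
      exact h2 X)
  exact exists_equiv_of_localizations (B₁.inverseImage Φ₁).trW
    (Φ₁ ⋙ DerivedCategory.Qh) (Φ₂ ⋙ DerivedCategory.Qh)

end Cplx
end NakDer
end

section
namespace NakDer
open CategoryTheory Category Limits

/-- Representations of the linear quiver, as functors on the poset `Fin n`, with maps
`a → b` vanishing whenever `Z a b`. -/
structure Rep (k : Type) [Field k] (n : ℕ) (Z : Fin n → Fin n → Prop) where
  X : Fin n → Type
  [ac : ∀ i, AddCommGroup (X i)]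
  [mo : ∀ i, Module k (X i)]
  map : ∀ i j, i ≤ j → (X i →ₗ[k] X j)
  map_id : ∀ i h x, map i i h x = x
  map_comp : ∀ i j l (hij : i ≤ j) (hjl : j ≤ l) x,
    map j l hjl (map i j hij x) = map i l (hij.trans hjl) x
  rel : ∀ a b h, Z a b → ∀ x, map a b h x = 0

attribute [instance] Rep.ac Rep.mo

namespace Rep
variable {k : Type} [Field k] {n : ℕ} {Z : Fin n → Fin n → Prop}

/-- Morphisms of representations. -/
@[ext] structure Hom (M N : Rep k n Z) where
  f : ∀ i, M.X i →ₗ[k] N.X i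
  comm : ∀ i j h x, f j (M.map i j h x) = N.map i j h (f i x)

instance : Category (Rep k n Z) where
  Hom := Hom
  id M := ⟨fun i => LinearMap.id, fun i j h x => rfl⟩
  comp f g := ⟨fun i => (g.f i).comp (f.f i), fun i j h x => by simp [f.comm, g.comm]⟩

@[simp] lemma id_f (M : Rep k n Z) (i) (x : M.X i) : Hom.f (𝟙 M) i x = x := rfl
@[simp] lemma comp_f {M N P : Rep k n Z} (f : M ⟶ N) (g : N ⟶ P) (i) (x : M.X i) :
  Hom.f (f ≫ g) i x = g.f i (f.f i x) := rfl

lemma hom_ext {M N : Rep k n Z} {f g : M ⟶ N} (h : ∀ i x, f.f i x = g.f i x) : f = g :=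
  Hom.ext (funext fun i => LinearMap.ext (h i))

instance (M N : Rep k n Z) : Zero (M ⟶ N) := ⟨⟨fun _ => 0, fun i j h x => by simp⟩⟩
instance (M N : Rep k n Z) : Add (M ⟶ N) :=
  ⟨fun f g => ⟨fun i => f.f i + g.f i, fun i j h x => by simp [f.comm, g.comm]⟩⟩
instance (M N : Rep k n Z) : Neg (M ⟶ N) :=
  ⟨fun f => ⟨fun i => - f.f i, fun i j h x => by simp [f.comm]⟩⟩
@[simp] lemma zero_f (M N : Rep k n Z) (i) (x : M.X i) : Hom.f (0 : M ⟶ N) i x = 0 := rfl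
@[simp] lemma add_f {M N : Rep k n Z} (f g : M ⟶ N) (i) (x : M.X i) :
  Hom.f (f + g) i x = f.f i x + g.f i x := rfl
@[simp] lemma neg_f {M N : Rep k n Z} (f : M ⟶ N) (i) (x : M.X i) :
  Hom.f (- f) i x = - f.f i x := rfl

instance (M N : Rep k n Z) : AddCommGroup (M ⟶ N) where
  add_assoc f g h := hom_ext fun i x => by simp [add_assoc]
  zero_add f := hom_ext fun i x => by simp
  add_zero f := hom_ext fun i x => by simp
  add_comm f g := hom_ext fun i x => by simp [add_comm]
  neg_add_cancel f := hom_ext fun i x => by simp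
  nsmul := nsmulRec
  zsmul := zsmulRec

instance : Preadditive (Rep k n Z) where
  add_comp P Q R f f' g := hom_ext fun i x => by simp
  comp_add P Q R f g g' := hom_ext fun i x => by simp

/-- The operator on the total space. -/
noncomputable def tm (M : Rep k n Z) (i j : Fin n) (h : i ≤ j) : (∀ i, M.X i) →ₗ[k] (∀ i, M.X i) :=
  (LinearMap.single k M.X j).comp ((M.map i j h).comp (LinearMap.proj i))

lemma tm_apply (M : Rep k n Z) (i j : Fin n) (h : i ≤ j) (x) :
    M.tm i j h x = Pi.single j (M.map i j h (x i)) := rfl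

lemma tm_tm (M : Rep k n Z) (i j l : Fin n) (h : i ≤ j) (h' : j ≤ l) :
    (M.tm j l h').comp (M.tm i j h) = M.tm i l (h.trans h') := by
  refine LinearMap.ext fun x => ?_
  simp [tm_apply, M.map_comp]

lemma tm_tm_ne (M : Rep k n Z) (i j j' l : Fin n) (h : i ≤ j) (h' : j' ≤ l) (e : j ≠ j') :
    (M.tm j' l h').comp (M.tm i j h) = 0 := by
  refine LinearMap.ext fun x => ?_
  simp [tm_apply, Pi.single_eq_of_ne e.symm]

lemma tm_sum (M : Rep k n Z) : ∑ i, M.tm i i le_rfl = 1 := by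
  refine LinearMap.ext fun x => ?_
  simp only [LinearMap.sum_apply, tm_apply, M.map_id]
  exact Finset.univ_sum_single x

end Rep
end NakDer
end

section
namespace NakDer
open CategoryTheory Category Limits MulOpposite

section Alg
variable (k : Type) [Field k] (n : ℕ)

/-- relation paths attached to a set of pairs -/
def RQ (Q : Set (ℕ × ℕ)) : Set (List (linQuiver n).A) :=
  {p | ∃ q ∈ Q, p = linPath n q.1 q.2}

/-- vanishing pairs attached to a set of relations -/
def ZQ (Q : Set (ℕ × ℕ)) (a b : Fin n) : Prop :=
  ∃ q ∈ Q, a.1 = q.1 - 1 ∧ b.1 = q.1 - 1 + q.2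

/-- the algebra -/
abbrev AQ (Q : Set (ℕ × ℕ)) : Type := PathAlgebraRel k (linQuiver n) (RQ n Q)

/-- relations are inside the quiver -/
def Good (Q : Set (ℕ × ℕ)) : Prop := ∀ q ∈ Q, 1 ≤ q.1 ∧ 1 ≤ q.2 ∧ q.1 + q.2 ≤ n

variable {k n}
lemma linPath_map_prod {B : Type} [MonoidWithZero B] (g : (linQuiver n).A → B) (v l : ℕ) (hv : 1 ≤ v)
    (hl : v + l ≤ n) :
    ((linPath n v l).map g).prod =
      ((List.range l).map fun j => if h : v - 1 + j < n - 1 then g ⟨v - 1 + j, h⟩ else 0).prod := by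
  congr 1
  unfold linPath
  rw [List.map_filterMap, ← List.filterMap_eq_map]
  refine List.filterMap_congr fun j hj => ?_
  have : v - 1 + j < n - 1 := by have := List.mem_range.1 hj; omega
  simp only [this, dif_pos, Function.comp]
  rfl

section Lift
variable {Z : Fin n → Fin n → Prop} (M : Rep k n Z)

/-- action of generators -/
noncomputable def genAct : (linQuiver n).V ⊕ (linQuiver n).A → (Module.End k (∀ i, M.X i))ᵐᵒᵖ :=
  Sum.elim (fun v => op (M.tm v v le_rfl))
    (fun a => op (M.tm ((linQuiver n).s a) ((linQuiver n).t a)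
      (by show a.1 ≤ a.1 + 1; omega)))

lemma genAct_inl (v : Fin n) : genAct M (Sum.inl v) = op (M.tm v v le_rfl) := rfl
lemma genAct_inr (a : ℕ) (h : a < n - 1) : genAct M (Sum.inr (⟨a, h⟩ : Fin (n - 1))) =
  op (M.tm ⟨a, by omega⟩ ⟨a + 1, by omega⟩ (by show a ≤ a + 1; omega)) := rfl

lemma genAct_path (a : ℕ) : ∀ (l : ℕ) (h : a + (l + 1) < n),
    ((List.range (l + 1)).map fun j => if h : a + j < n - 1 then
      genAct M (Sum.inr (⟨a + j, h⟩ : Fin (n - 1))) else 0).prod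
    = op (M.tm ⟨a, by omega⟩ ⟨a + (l + 1), h⟩ (by show a ≤ a + (l + 1); omega))
  | 0, h => by
    have : a < n - 1 := by omega
    simp [this, genAct_inr]
  | l + 1, h => by
    have h' : a + (l + 1) < n - 1 := by omega
    rw [List.range_succ, List.map_append, List.prod_append, genAct_path a l (by omega)]
    simp only [List.map_cons, List.map_nil, List.prod_singleton, dif_pos h']
    rw [genAct_inr, ← op_mul]
    exact congrArg op (M.tm_tm _ _ _ _ _)

end Lift

variable {Q : Set (ℕ × ℕ)} (hQ : Good n Q) (M : Rep k n (ZQ n Q))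

include hQ in
lemma genAct_rel (x y) (h : PathAlgRel k (linQuiver n) (RQ n Q) x y) :
    FreeAlgebra.lift k (genAct M) x = FreeAlgebra.lift k (genAct M) y := by
  induction h with
  | idem v =>
    simp only [map_mul, FreeAlgebra.lift_ι_apply]
    exact congrArg op (M.tm_tm _ _ _ _ _)
  | orth v w h =>
    simp only [map_mul, FreeAlgebra.lift_ι_apply, map_zero]
    exact congrArg op (M.tm_tm_ne _ _ _ _ _ _ h)
  | unit =>
    simp only [map_sum, FreeAlgebra.lift_ι_apply, map_one]
    refine (Finset.op_sum _ _).symm.trans (congrArg op M.tm_sum)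
  | source a =>
    simp only [map_mul, FreeAlgebra.lift_ι_apply]
    exact congrArg op (M.tm_tm _ _ _ _ _)
  | target a =>
    simp only [map_mul, FreeAlgebra.lift_ι_apply]
    exact congrArg op (M.tm_tm _ _ _ _ _)
  | zeroRel p hp =>
    obtain ⟨⟨v, l⟩, hq, rfl⟩ := hp
    obtain ⟨h1, h2, h3⟩ := hQ _ hq
    obtain ⟨l, rfl⟩ := Nat.exists_eq_succ_of_ne_zero (by omega : l ≠ 0)
    rw [map_list_prod, List.map_map, map_zero]
    have e : (⇑(FreeAlgebra.lift k (genAct M)) ∘ fun a => FreeAlgebra.ι k (Sum.inr a)) =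
      fun a => genAct M (Sum.inr a) := by
      funext a; simp
    rw [e, linPath_map_prod _ _ _ h1 h3]
    refine (genAct_path M (v - 1) l (by simp only at *; omega)).trans ?_
    rw [op_eq_zero_iff]
    refine LinearMap.ext fun x => ?_
    rw [M.tm_apply, M.rel _ _ _ ⟨_, hq, rfl, rfl⟩]
    simp

/-- the representation as an algebra map -/
noncomputable def repHom : AQ k n Q →ₐ[k] (Module.End k (∀ i, M.X i))ᵐᵒᵖ :=
  RingQuot.liftAlgHom k ⟨FreeAlgebra.lift k (genAct M), genAct_rel hQ M⟩

/-- generator -/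
noncomputable def eA (k : Type) [Field k] (Q : Set (ℕ × ℕ)) (v : Fin n) : AQ k n Q :=
  RingQuot.mkAlgHom k _ (FreeAlgebra.ι k (Sum.inl v))
/-- generator -/
noncomputable def aA (k : Type) [Field k] (Q : Set (ℕ × ℕ)) (v : Fin (n - 1)) : AQ k n Q :=
  RingQuot.mkAlgHom k _ (FreeAlgebra.ι k (Sum.inr v))

lemma repHom_eA (v : Fin n) : repHom hQ M (eA k Q v) = op (M.tm v v le_rfl) := by
  simp only [repHom, eA, RingQuot.liftAlgHom_mkAlgHom_apply, FreeAlgebra.lift_ι_apply]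
  rfl

lemma repHom_aA (a : Fin (n - 1)) : repHom hQ M (aA k Q a) =
    op (M.tm ((linQuiver n).s a) ((linQuiver n).t a) (by show a.1 ≤ a.1 + 1; omega)) := by
  simp only [repHom, aA, RingQuot.liftAlgHom_mkAlgHom_apply, FreeAlgebra.lift_ι_apply]
  rfl

/-- induction on elements of the algebra -/
lemma AQ_induction {P : AQ k n Q → Prop} (h1 : ∀ c : k, P (algebraMap k _ c))
    (h2 : ∀ v, P (eA k Q v)) (h3 : ∀ a, P (aA k Q a)) (h4 : ∀ x y, P x → P y → P (x + y))
    (h5 : ∀ x y, P x → P y → P (x * y)) (x) : P x := by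
  obtain ⟨x, rfl⟩ := RingQuot.mkAlgHom_surjective k _ x
  induction x using FreeAlgebra.induction with
  | grade0 c => rw [AlgHom.commutes]; exact h1 c
  | grade1 g => rcases g with v | a; exacts [h2 v, h3 a]
  | mul x y hx hy => rw [map_mul]; exact h5 _ _ hx hy
  | add x y hx hy => rw [map_add]; exact h4 _ _ hx hy

lemma lin_of_gens {N N' : Type} [AddCommGroup N] [AddCommGroup N'] [Module (AQ k n Q)ᵐᵒᵖ N]
    [Module (AQ k n Q)ᵐᵒᵖ N'] (g : N →+ N')
    (h1 : ∀ (c : k) x, g (op (algebraMap k (AQ k n Q) c) • x) = op (algebraMap k (AQ k n Q) c) • g x)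
    (h2 : ∀ (v : Fin n) x, g (op (eA k Q v) • x) = op (eA k Q v) • g x)
    (h3 : ∀ (a : Fin (n - 1)) x, g (op (aA k Q a) • x) = op (aA k Q a) • g x) (a : (AQ k n Q)ᵐᵒᵖ) (x) :
    g (a • x) = a • g x := by
  induction a using MulOpposite.rec' with
  | h a =>
  revert x
  refine AQ_induction (P := fun a => ∀ x, g (op a • x) = op a • g x) h1 h2 h3 ?_ ?_ a
  · intro a b ha hb x; simp [add_smul, ha, hb]
  · intro a b ha hb x; simp [mul_smul, ha, hb]

end Alg
end NakDer
end

section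
namespace NakDer
open CategoryTheory Category Limits MulOpposite

section FunctorL
variable {k : Type} [Field k] {n : ℕ} {Q : Set (ℕ × ℕ)} (hQ : Good n Q)

/-- total space of a representation -/
def LObj (_ : Good n Q) (M : Rep k n (ZQ n Q)) : Type := ∀ i, M.X i

instance (M : Rep k n (ZQ n Q)) : AddCommGroup (LObj hQ M) :=
  inferInstanceAs (AddCommGroup (∀ i, M.X i))

/-- ring hom giving the action -/
noncomputable def actHom (M : Rep k n (ZQ n Q)) : (AQ k n Q)ᵐᵒᵖ →+* Module.End k (∀ i, M.X i) where
  toFun a := unop (repHom hQ M (unop a))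
  map_one' := by simp
  map_mul' a b := by simp
  map_zero' := by simp
  map_add' a b := by simp

noncomputable instance (M : Rep k n (ZQ n Q)) : Module (AQ k n Q)ᵐᵒᵖ (LObj hQ M) :=
  Module.compHom (∀ i, M.X i) (actHom hQ M)

variable {hQ} in
lemma smul_eq {M : Rep k n (ZQ n Q)} (a : AQ k n Q) (x : LObj hQ M) :
    op a • x = (unop (repHom hQ M a) : Module.End k (∀ i, M.X i)) x := rfl

variable {hQ} in
lemma smul_k {M : Rep k n (ZQ n Q)} (c : k) (x : LObj hQ M) :
    op (algebraMap k (AQ k n Q) c) • x = fun i => c • x i := by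
  rw [smul_eq, AlgHom.commutes]; rfl

variable {hQ} in
lemma smul_e {M : Rep k n (ZQ n Q)} (v : Fin n) (x : LObj hQ M) :
    op (eA k Q v) • x = (Pi.single v (x v) : ∀ i, M.X i) := by
  rw [smul_eq, repHom_eA, unop_op]
  refine (M.tm_apply _ _ _ x).trans ?_
  rw [M.map_id]

variable {hQ} in
lemma smul_a {M : Rep k n (ZQ n Q)} (a : ℕ) (ha : a < n - 1) (x : LObj hQ M) :
    op (aA k Q ⟨a, ha⟩) • x = (Pi.single ⟨a + 1, by omega⟩ (M.map ⟨a, by omega⟩ ⟨a + 1, by omega⟩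
      (by show a ≤ a + 1; omega) (x ⟨a, by omega⟩)) : ∀ i, M.X i) := by
  rw [smul_eq, repHom_aA, unop_op]
  exact M.tm_apply _ _ _ x

/-- componentwise map -/
def LMap {M N : Rep k n (ZQ n Q)} (f : M ⟶ N) : LObj hQ M →+ LObj hQ N where
  toFun x := fun i => f.f i (x i)
  map_zero' := funext fun i => map_zero (f.f i)
  map_add' _ _ := funext fun i => map_add (f.f i) _ _

lemma single_map {M N : Rep k n (ZQ n Q)} (f : M ⟶ N) (j : Fin n) (y : M.X j) :
    (fun i => f.f i (Pi.single (M := M.X) j y i)) = Pi.single (M := N.X) j (f.f j y) := by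
  funext i
  by_cases h : i = j
  · subst h; simp
  · simp [Pi.single_eq_of_ne h]

lemma comm_of_steps {Z : Fin n → Fin n → Prop} {M N : Rep k n Z} (f : ∀ i, M.X i → N.X i)
    (h : ∀ (a : ℕ) (ha : a + 1 < n) (x : M.X ⟨a, by omega⟩),
      f ⟨a + 1, ha⟩ (M.map ⟨a, by omega⟩ ⟨a + 1, ha⟩ (by show a ≤ a + 1; omega) x) =
      N.map ⟨a, by omega⟩ ⟨a + 1, ha⟩ (by show a ≤ a + 1; omega) (f ⟨a, by omega⟩ x))
    (i j : Fin n) (hij : i ≤ j) (x : M.X i) : f j (M.map i j hij x) = N.map i j hij (f i x) := by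
  obtain ⟨i, hi⟩ := i
  obtain ⟨j, hj⟩ := j
  obtain ⟨m, rfl⟩ := Nat.exists_eq_add_of_le (show i ≤ j from hij)
  induction m with
  | zero => simp only [Nat.add_zero, M.map_id, N.map_id]
  | succ m ih =>
    have h1 := ih (by omega) (by show i ≤ i + m; omega)
    have h2 := h (i + m) hj (M.map ⟨i, hi⟩ ⟨i + m, by omega⟩ (by show i ≤ i + m; omega) x)
    rw [h1, M.map_comp, N.map_comp] at h2
    exact h2

/-- The functor from representations to right modules. -/
noncomputable def L : Rep k n (ZQ n Q) ⥤ ModuleCat.{0} (AQ k n Q)ᵐᵒᵖ where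
  obj M := ModuleCat.of _ (LObj hQ M)
  map {M N} f := ModuleCat.ofHom
    { toFun := LMap hQ f
      map_add' := map_add _
      map_smul' := lin_of_gens (LMap hQ f)
        (fun c x => by rw [smul_k, smul_k]; exact funext fun i => map_smul (f.f i) _ _)
        (fun v x => by rw [smul_e, smul_e]; exact single_map f _ _)
        (fun ⟨a, ha⟩ x => by
          rw [smul_a, smul_a]; refine (single_map f _ _).trans ?_; rw [f.comm]; rfl) }
  map_id M := rfl
  map_comp f g := rfl

variable {hQ} in
lemma L_map_apply {M N : Rep k n (ZQ n Q)} (f : M ⟶ N) (x : ∀ i, M.X i) :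
    ((L hQ).map f).hom x = fun i => f.f i (x i) := rfl

instance : (L (k := k) hQ).Additive := ⟨rfl⟩

instance : (L (k := k) hQ).Faithful := ⟨fun {M N f g} h => Rep.hom_ext fun i x => by
  have h1 := congrArg (fun u => u.hom (Pi.single (M := M.X) i x)) h
  have h2 := congrFun h1 i
  change f.f i (Pi.single (M := M.X) i x i) = g.f i (Pi.single (M := M.X) i x i) at h2
  simpa using h2⟩

instance : (L (k := k) hQ).Full := ⟨fun {M N} g => by
  have key : ∀ (x : LObj hQ M) (i : Fin n),
      (g.hom x : ∀ i, N.X i) i = (g.hom (Pi.single (M := M.X) i (x i)) : ∀ i, N.X i) i := by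
    intro x i
    have h1 := g.hom.map_smul (op (eA k Q i)) x
    have h2 : op (eA k Q i) • g.hom x =
      (Pi.single i ((g.hom x : ∀ i, N.X i) i) : ∀ i, N.X i) := smul_e (hQ := hQ) (M := N) i (g.hom x)
    have h3 : op (eA k Q i) • x = (Pi.single i (x i) : ∀ i, M.X i) := smul_e i x
    rw [h2] at h1
    have h4 := congrFun h1 i
    rw [Pi.single_eq_same] at h4
    rw [← h4]
    exact congrArg (fun y => (g.hom y : ∀ i, N.X i) i) h3
  refine ⟨⟨fun i =>
    { toFun := fun x => (g.hom (Pi.single (M := M.X) i x) : ∀ i, N.X i) i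
      map_add' := fun x y => by
        rw [Pi.single_add]
        exact congrFun (g.hom.map_add (Pi.single (M := M.X) i x) _) i
      map_smul' := fun c x => by
        have h1 := g.hom.map_smul (op (algebraMap k (AQ k n Q) c)) (Pi.single (M := M.X) i x)
        have h2 := congrFun h1 i
        erw [smul_k, smul_k] at h2
        refine Eq.trans ?_ h2
        rw [Pi.single_smul]
        rfl }, ?_⟩, ?_⟩
  · intro i j h x
    refine comm_of_steps (fun i x => (g.hom (Pi.single (M := M.X) i x) : ∀ i, N.X i) i) ?_ i j h x
    intro a ha x
    have h1 := g.hom.map_smul (op (aA k Q ⟨a, by omega⟩))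
      (Pi.single (M := M.X) ⟨a, by omega⟩ x : LObj hQ M)
    have h2 := smul_a (hQ := hQ) (M := N) a (by omega)
      (g.hom (Pi.single (M := M.X) ⟨a, by omega⟩ x))
    have h3 := smul_a (hQ := hQ) a (by omega) (Pi.single (M := M.X) ⟨a, by omega⟩ x : LObj hQ M)
    have h4 := congrFun (h1.trans h2) ⟨a + 1, ha⟩
    rw [Pi.single_eq_same] at h4
    refine Eq.trans ?_ h4
    refine Eq.trans ?_ (congrArg (fun y => (g.hom y : ∀ i, N.X i) ⟨a + 1, ha⟩) h3.symm)
    rw [Pi.single_eq_same]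
  · ext x
    exact funext fun i => (key x i).symm⟩

end FunctorL
end NakDer
end

section
namespace NakDer
open CategoryTheory Category Limits MulOpposite

section Ess
variable {k : Type} [Field k] {n : ℕ} {Q : Set (ℕ × ℕ)}

lemma eA_mul_self (v : Fin n) : eA k Q v * eA k Q v = eA k Q v := by
  have := RingQuot.mkAlgHom_rel k (PathAlgRel.idem (k := k) (Q := linQuiver n) (R := RQ n Q) v)
  rwa [map_mul] at this

lemma eA_mul_ne (v w : Fin n) (h : v ≠ w) : eA k Q v * eA k Q w = 0 := by
  have := RingQuot.mkAlgHom_rel k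
    (PathAlgRel.orth (k := k) (Q := linQuiver n) (R := RQ n Q) v w h)
  rwa [map_mul, map_zero] at this

lemma eA_sum : ∑ v : Fin n, eA k Q v = 1 := by
  have := RingQuot.mkAlgHom_rel k
    (PathAlgRel.unit (k := k) (Q := linQuiver n) (R := RQ n Q))
  rwa [map_sum, map_one] at this

lemma eA_aA (a : Fin (n - 1)) : eA k Q ((linQuiver n).s a) * aA k Q a = aA k Q a := by
  have := RingQuot.mkAlgHom_rel k
    (PathAlgRel.source (k := k) (Q := linQuiver n) (R := RQ n Q) a)
  rwa [map_mul] at this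

lemma aA_eA (a : Fin (n - 1)) : aA k Q a * eA k Q ((linQuiver n).t a) = aA k Q a := by
  have := RingQuot.mkAlgHom_rel k
    (PathAlgRel.target (k := k) (Q := linQuiver n) (R := RQ n Q) a)
  rwa [map_mul] at this

/-- the path element -/
noncomputable def pth (k : Type) [Field k] (n : ℕ) (Q : Set (ℕ × ℕ)) (a l : ℕ) : AQ k n Q :=
  ((List.range l).map fun j => if h : a + j < n - 1 then aA k Q ⟨a + j, h⟩ else 0).prod

lemma pth_zero (a : ℕ) : pth k n Q a 0 = 1 := by simp [pth]

lemma pth_succ (a l : ℕ) : pth k n Q a (l + 1) = pth k n Q a l *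
    (if h : a + l < n - 1 then aA k Q ⟨a + l, h⟩ else 0) := by
  simp [pth, List.range_succ]

lemma pth_add (a l l' : ℕ) : pth k n Q a (l + l') = pth k n Q a l * pth k n Q (a + l) l' := by
  induction l' with
  | zero => simp [pth_zero]
  | succ m ih => rw [← Nat.add_assoc, pth_succ, pth_succ, ih, mul_assoc]; simp only [Nat.add_assoc]

lemma pth_rel (hQ : Good n Q) (q) (hq : q ∈ Q) : pth k n Q (q.1 - 1) q.2 = 0 := by
  have := RingQuot.mkAlgHom_rel k
    (PathAlgRel.zeroRel (k := k) (Q := linQuiver n) (R := RQ n Q) _ ⟨q, hq, rfl⟩)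
  obtain ⟨h1, h2, h3⟩ := hQ _ hq
  rw [map_list_prod, List.map_map, map_zero, linPath_map_prod _ _ _ h1 h3] at this
  exact this

/-- path from `i` to `j` -/
noncomputable def pij (k : Type) [Field k] (Q : Set (ℕ × ℕ)) (i j : Fin n) : AQ k n Q :=
  eA k Q i * pth k n Q i (j - i)

lemma pij_self (i : Fin n) : pij k Q i i = eA k Q i := by simp [pij, pth_zero]

lemma eA_pij (i j : Fin n) : eA k Q i * pij k Q i j = pij k Q i j := by
  rw [pij, ← mul_assoc, eA_mul_self]

lemma pij_eA (i j : Fin n) (h : i ≤ j) : pij k Q i j * eA k Q j = pij k Q i j := by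
  obtain ⟨i, hi⟩ := i
  obtain ⟨j, hj⟩ := j
  obtain ⟨m, rfl⟩ := Nat.exists_eq_add_of_le (show i ≤ j from h)
  rcases m with _ | m
  · simp only [Nat.add_zero, pij_self, eA_mul_self]
  · have h' : i + m < n - 1 := by omega
    simp only [pij, Nat.add_sub_cancel_left, pth_succ, dif_pos h', mul_assoc]
    rw [show eA k Q ⟨i + (m + 1), hj⟩ = eA k Q ((linQuiver n).t ⟨i + m, h'⟩) from rfl, aA_eA]

lemma pij_pij (i j l : Fin n) (h : i ≤ j) (h' : j ≤ l) : pij k Q i j * pij k Q j l = pij k Q i l := by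
  conv_lhs => rw [pij.eq_1 k Q j l, ← mul_assoc, pij_eA i j h, pij, mul_assoc]
  have h1 : (i : ℕ) ≤ j := h
  have h2 : (j : ℕ) ≤ l := h'
  have : pth k n Q j (l - j) = pth k n Q (i + (j - i)) (l - j) := by congr 1; omega
  rw [this, ← pth_add, pij]
  congr 2
  omega

lemma pij_step (a : ℕ) (h : a < n - 1) : pij k Q (n := n) ⟨a, by omega⟩ ⟨a + 1, by omega⟩ =
    aA k Q ⟨a, h⟩ := by
  simp only [pij, Nat.add_sub_cancel_left, pth_succ a 0, pth_zero, one_mul, Nat.add_zero,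
    dif_pos h]
  exact eA_aA ⟨a, h⟩

variable (N : Type) [AddCommGroup N] [Module (AQ k n Q)ᵐᵒᵖ N] [Module k N]
  [IsScalarTower k (AQ k n Q)ᵐᵒᵖ N]

lemma smul_comm' (a : (AQ k n Q)ᵐᵒᵖ) (c : k) (x : N) : a • c • x = c • a • x := by
  rw [← algebraMap_smul (AQ k n Q)ᵐᵒᵖ c x, ← algebraMap_smul (AQ k n Q)ᵐᵒᵖ c (a • x), smul_smul,
    smul_smul, Algebra.commutes]

/-- component of a module -/
def comp (i : Fin n) : Submodule k N where
  carrier := {x | op (eA k Q i) • x = x}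
  add_mem' {x y} hx hy := by
    simp only [Set.mem_ofPred_eq] at *; rw [smul_add, hx, hy]
  zero_mem' := smul_zero _
  smul_mem' c x hx := by
    simp only [Set.mem_ofPred_eq] at *; rw [smul_comm', hx]

variable {N} in
lemma mem_comp {i : Fin n} {x : N} : x ∈ comp (k := k) (Q := Q) N i ↔ op (eA k Q i) • x = x :=
  Iff.rfl

variable (k)

/-- The representation attached to a module. -/
noncomputable def ofMod (hQ : Good n Q) : Rep k n (ZQ n Q) where
  X i := comp (k := k) (Q := Q) N i
  map i j h :=
    { toFun := fun x => ⟨op (pij k Q i j) • x.1, by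
        rw [mem_comp, smul_smul, ← op_mul, pij_eA i j h]⟩
      map_add' := fun x y => Subtype.ext (smul_add _ _ _)
      map_smul' := fun c x => Subtype.ext (smul_comm' _ _ _ _) }
  map_id i h x := Subtype.ext (by
    show op (pij k Q i i) • x.1 = x.1
    rw [pij_self]; exact x.2)
  map_comp i j l hij hjl x := Subtype.ext (by
    show op (pij k Q j l) • op (pij k Q i j) • x.1 = op (pij k Q i l) • x.1
    rw [smul_smul, ← op_mul, pij_pij i j l hij hjl])
  rel := by
    rintro a b h ⟨q, hq, ha, hb⟩ x
    refine Subtype.ext ?_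
    show op (pij k Q a b) • x.1 = 0
    have : pij k Q a b = 0 := by
      rw [pij, show (b : ℕ) - a = q.2 by omega, ha, pth_rel hQ q hq, mul_zero]
    rw [this]; simp

variable {k N} in
/-- underlying element -/
def vl {hQ : Good n Q} {i : Fin n} (x : (ofMod k N hQ).X i) : N :=
  Subtype.val (p := fun y => y ∈ comp (k := k) (Q := Q) N i) x

/-- summation map -/
noncomputable def sumMap (hQ : Good n Q) : LObj hQ (ofMod k N hQ) →+ N where
  toFun x := ∑ i, (vl (x i))
  map_zero' := Finset.sum_eq_zero fun i _ => rfl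
  map_add' x y := by rw [← Finset.sum_add_distrib]; rfl

lemma sumMap_single (hQ : Good n Q) (i : Fin n) (x : (ofMod k N hQ).X i) :
    sumMap k N hQ (Pi.single (M := (ofMod k N hQ).X) i x) = vl x := by
  show ∑ j, vl (Pi.single (M := (ofMod k N hQ).X) i x j) = vl x
  rw [Finset.sum_eq_single i]
  · rw [Pi.single_eq_same]
  · intro j _ h; rw [Pi.single_eq_of_ne h]; rfl
  · simp

lemma e_smul_sumMap (hQ : Good n Q) (v : Fin n) (x : LObj hQ (ofMod k N hQ)) :
    op (eA k Q v) • sumMap k N hQ x = (vl (x v)) := by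
  show op (eA k Q v) • ∑ j, (vl (x j)) = (vl (x v))
  rw [Finset.smul_sum, Finset.sum_eq_single v]
  · exact (x v).2
  · intro j _ h
    have : (vl (x j)) = op (eA k Q j) • (vl (x j)) := (x j).2.symm
    rw [this, smul_smul, ← op_mul, eA_mul_ne j v h]; simp
  · simp

/-- `sumMap` as linear map -/
noncomputable def sumLin (hQ : Good n Q) : LObj hQ (ofMod k N hQ) →ₗ[(AQ k n Q)ᵐᵒᵖ] N where
  toFun := sumMap k N hQ
  map_add' := map_add _
  map_smul' := lin_of_gens (sumMap k N hQ)
    (fun c x => by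
      rw [smul_k]
      show ∑ i, c • (vl (x i)) = op (algebraMap k (AQ k n Q) c) • ∑ i, (vl (x i))
      rw [← Finset.smul_sum]
      exact (algebraMap_smul (AQ k n Q)ᵐᵒᵖ c _).symm)
    (fun v x => by
      rw [e_smul_sumMap, smul_e]
      exact sumMap_single k N hQ v _)
    (fun ⟨a, ha⟩ x => by
      rw [smul_a, ← pij_step, ← eA_pij, op_mul, mul_smul, e_smul_sumMap]
      exact sumMap_single k N hQ _ _)

lemma sumLin_bij (hQ : Good n Q) : Function.Bijective (sumLin k N hQ) := by
  constructor
  · intro x y h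
    refine funext fun v => Subtype.ext ?_
    show vl (x v) = vl (y v)
    rw [← e_smul_sumMap, ← e_smul_sumMap]
    exact congrArg _ h
  · intro y
    refine ⟨fun i => ⟨op (eA k Q i) • y, ?_⟩, ?_⟩
    · rw [mem_comp, smul_smul, ← op_mul, eA_mul_self]
    · show ∑ i, op (eA k Q i) • y = y
      rw [← Finset.sum_smul, ← Finset.op_sum, eA_sum]; simp

open scoped ModuleCat in
instance (hQ : Good n Q) : (L (k := k) hQ).EssSurj := ⟨fun N =>
  ⟨ofMod k N hQ, ⟨(LinearEquiv.ofBijective (sumLin k N hQ) (sumLin_bij k N hQ)).toModuleIso⟩⟩⟩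

instance (hQ : Good n Q) : (L (k := k) hQ).IsEquivalence where

end Ess
end NakDer
end

section
namespace NakDer
open CategoryTheory Category Limits MulOpposite

section AbsPack
variable {R C E : Type*} [Category R] [Category C] [Category E] [Preadditive R]
  [Preadditive E] [HasZeroObject E]
  [HasBinaryBiproducts E] [Abelian C] (F : E ⥤ R) [F.Additive] [F.Full] [F.Faithful]
  (D : R ⥤ E) [D.Additive] (L : R ⥤ C) [L.Additive] [L.Full] [L.Faithful]
  (inv : C ⥤ R) [inv.Additive] (cc : ∀ M, L.obj (inv.obj M) ≅ M)
  (hc : ∀ {M N} (f : M ⟶ N), L.map (inv.map f) ≫ (cc N).hom = (cc M).hom ≫ f)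

/-- auxiliary natural transformation -/
def auxL (e : D ⋙ F ⟶ 𝟭 _) : (inv ⋙ D) ⋙ (F ⋙ L) ⟶ 𝟭 C where
  app M := L.map (e.app (inv.obj M)) ≫ (cc M).hom
  naturality M N f := by
    have h2 : F.map (D.map (inv.map f)) ≫ e.app (inv.obj N) = e.app (inv.obj M) ≫ inv.map f :=
      e.naturality (inv.map f)
    show L.map (F.map (D.map (inv.map f))) ≫ L.map (e.app (inv.obj N)) ≫ (cc N).hom =
      (L.map (e.app (inv.obj M)) ≫ (cc M).hom) ≫ f
    rw [← assoc, ← L.map_comp, h2, L.map_comp, assoc, assoc]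
    exact congrArg _ (hc f)

/-- auxiliary natural transformation -/
def auxR (e : 𝟭 _ ⟶ D ⋙ F) : 𝟭 C ⟶ (inv ⋙ D) ⋙ (F ⋙ L) where
  app M := (cc M).inv ≫ L.map (e.app (inv.obj M))
  naturality M N f := by
    have h2 : inv.map f ≫ e.app (inv.obj N) = e.app (inv.obj M) ≫ F.map (D.map (inv.map f)) :=
      e.naturality (inv.map f)
    show f ≫ (cc N).inv ≫ L.map (e.app (inv.obj N)) =
      ((cc M).inv ≫ L.map (e.app (inv.obj M))) ≫ L.map (F.map (D.map (inv.map f)))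
    rw [assoc, ← L.map_comp, ← h2, L.map_comp, ← assoc, ← assoc]
    have h3 : f ≫ (cc N).inv = (cc M).inv ≫ L.map (inv.map f) := by
      rw [Iso.comp_inv_eq, assoc, hc, Iso.inv_hom_id_assoc]
    rw [h3]

include hc in
lemma HL_abs (e : D ⋙ F ⟶ 𝟭 _) (he : ∀ M, Epi (L.map (e.app M)))
    (P : ℕ → R → Prop) (m : ℕ) (h0 : ∀ M, P 0 M)
    (hm : ∀ M, P m M → IsZero (L.obj M))
    (hs : ∀ (c : ℕ) (N M : R) (i : N ⟶ F.obj (D.obj M)),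
      Mono (L.map i) → i ≫ e.app M = 0 → P c M → P (c + 1) N)
    (X : CochainComplex C ℤ) : HL (F ⋙ L) X := by
  have hepi : ∀ M, Epi ((auxL F D L inv cc hc e).app M) := fun M => by
    have := he (inv.obj M)
    exact epi_comp (L.map (e.app (inv.obj M))) (cc M).hom
  refine HL_all (F ⋙ L) (inv ⋙ D) (auxL F D L inv cc hc e) (fun c M => P c (inv.obj M)) m
    (fun M => h0 _) (fun M hM => (hm _ hM).of_iso (cc M).symm) ?_ X
  intro c N M (i : N ⟶ L.obj (F.obj (D.obj (inv.obj M)))) _ hi hP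
  replace hi : i ≫ L.map (e.app (inv.obj M)) ≫ (cc M).hom = 0 := hi
  have hi' : L.map (L.preimage ((cc N).hom ≫ i)) = (cc N).hom ≫ i := L.map_preimage _
  refine hs c _ _ (L.preimage ((cc N).hom ≫ i)) ?_ ?_ hP
  · rw [hi']; exact mono_comp _ _
  · apply L.map_injective
    refine (L.map_comp _ _).trans ?_
    rw [Functor.map_zero, hi']
    have : i ≫ L.map (e.app (inv.obj M)) = 0 := by
      refine (cancel_mono (cc M).hom).1 ?_
      exact (assoc _ _ _).trans (hi.trans zero_comp.symm)
    refine (assoc _ _ _).trans ?_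
    rw [this]
    exact comp_zero

include hc in
lemma HR_abs (e : 𝟭 _ ⟶ D ⋙ F) (he : ∀ M, Mono (L.map (e.app M)))
    (P : ℕ → R → Prop) (m : ℕ) (h0 : ∀ M, P 0 M)
    (hm : ∀ M, P m M → IsZero (L.obj M))
    (hs : ∀ (c : ℕ) (N M : R) (i : F.obj (D.obj M) ⟶ N),
      Epi (L.map i) → e.app M ≫ i = 0 → P c M → P (c + 1) N)
    (X : CochainComplex C ℤ) : HR (F ⋙ L) X := by
  have hmono : ∀ M, Mono ((auxR F D L inv cc hc e).app M) := fun M => by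
    have := he (inv.obj M)
    exact mono_comp (cc M).inv (L.map (e.app (inv.obj M)))
  refine HR_all (F ⋙ L) (inv ⋙ D) (auxR F D L inv cc hc e) (fun c M => P c (inv.obj M)) m
    (fun M => h0 _) (fun M hM => (hm _ hM).of_iso (cc M).symm) ?_ X
  intro c N M (i : L.obj (F.obj (D.obj (inv.obj M))) ⟶ N) _ hi hP
  replace hi : ((cc M).inv ≫ L.map (e.app (inv.obj M))) ≫ i = 0 := hi
  have hi' : L.map (L.preimage (i ≫ (cc N).inv)) = i ≫ (cc N).inv := L.map_preimage _
  refine hs c _ _ (L.preimage (i ≫ (cc N).inv)) ?_ ?_ hP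
  · rw [hi']; exact epi_comp _ _
  · apply L.map_injective
    refine (L.map_comp _ _).trans ?_
    rw [Functor.map_zero, hi']
    have : L.map (e.app (inv.obj M)) ≫ i = 0 := by
      refine (cancel_epi (cc M).inv).1 ?_
      exact (assoc _ _ _).symm.trans (hi.trans comp_zero.symm)
    refine (assoc _ _ _).symm.trans ?_
    refine (congrArg (· ≫ (cc N).inv) this).trans ?_
    exact zero_comp

end AbsPack

section Pack
variable {k : Type} [Field k] {n : ℕ} {Q : Set (ℕ × ℕ)} {hQ : Good n Q}

lemma mono_L_map {M N : Rep k n (ZQ n Q)} (f : M ⟶ N) (h : ∀ i, Function.Injective (f.f i)) :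
    Mono ((L hQ).map f) := by
  rw [ModuleCat.mono_iff_injective]
  intro x y hxy
  exact funext fun i => h i (congrFun hxy i)

lemma epi_L_map {M N : Rep k n (ZQ n Q)} (f : M ⟶ N) (h : ∀ i, Function.Surjective (f.f i)) :
    Epi ((L hQ).map f) := by
  rw [ModuleCat.epi_iff_surjective]
  intro y
  choose g hg using h
  exact ⟨fun i => g i ((y : ∀ i, N.X i) i), funext fun i => hg i _⟩

lemma inj_of_mono {M N : Rep k n (ZQ n Q)} (f : M ⟶ N) (h : Mono ((L hQ).map f)) (i : Fin n) :
    Function.Injective (f.f i) := by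
  rw [ModuleCat.mono_iff_injective] at h
  intro x y hxy
  have : (Pi.single i x : ∀ i, M.X i) = Pi.single i y := by
    refine @h (Pi.single i x : ∀ i, M.X i) (Pi.single i y : ∀ i, M.X i) ?_
    show (fun j => f.f j (Pi.single (M := M.X) i x j)) = fun j => f.f j (Pi.single (M := M.X) i y j)
    rw [single_map, single_map, hxy]
  exact Pi.single_injective _ this

lemma surj_of_epi {M N : Rep k n (ZQ n Q)} (f : M ⟶ N) (h : Epi ((L hQ).map f)) (i : Fin n) :
    Function.Surjective (f.f i) := by
  rw [ModuleCat.epi_iff_surjective] at h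
  intro y
  obtain ⟨x, hx⟩ := h (Pi.single i y : ∀ i, N.X i)
  refine ⟨(x : ∀ i, M.X i) i, ?_⟩
  have := congrFun hx i
  rw [Pi.single_eq_same] at this
  exact this

lemma isZero_L {M : Rep k n (ZQ n Q)} (h : ∀ i, Subsingleton (M.X i)) :
    IsZero ((L hQ).obj M) := by
  have : Subsingleton ((L hQ).obj M) := inferInstanceAs (Subsingleton (∀ i, M.X i))
  exact ModuleCat.isZero_of_subsingleton _

variable {E : Type*} [Category E] [Preadditive E] [HasZeroObject E]
  [HasBinaryBiproducts E] (F : E ⥤ Rep k n (ZQ n Q)) [F.Additive] [F.Full] [F.Faithful]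
  (D : Rep k n (ZQ n Q) ⥤ E) [D.Additive]

variable (hQ) in
lemma inv_additive : (L (k := k) hQ).inv.Additive := by
  have : (L (k := k) hQ).asEquivalence.functor.Additive :=
    inferInstanceAs (L (k := k) hQ).Additive
  exact Equivalence.inverse_additive (L (k := k) hQ).asEquivalence

lemma HL_rep (e : D ⋙ F ⟶ 𝟭 _) (he : ∀ M i, Function.Surjective (Rep.Hom.f (e.app M) i))
    (P : ℕ → Rep k n (ZQ n Q) → Prop) (m : ℕ) (h0 : ∀ M, P 0 M)
    (hm : ∀ M, P m M → ∀ i, Subsingleton (M.X i))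
    (hs : ∀ (c : ℕ) (N M : Rep k n (ZQ n Q)) (i : N ⟶ F.obj (D.obj M)),
      (∀ v, Function.Injective (i.f v)) → i ≫ e.app M = 0 → P c M → P (c + 1) N)
    (X : CochainComplex (ModuleCat.{0} (AQ k n Q)ᵐᵒᵖ) ℤ) : HL (F ⋙ L hQ) X := by
  have := inv_additive (k := k) hQ
  exact HL_abs F D (L hQ) (L hQ).inv (fun M => (L hQ).asEquivalence.counitIso.app M)
    (fun f => (L hQ).asEquivalence.counitIso.hom.naturality f) e (fun M => epi_L_map _ (he M))
    P m h0 (fun M h => isZero_L (hm M h)) (fun c N M i h => hs c N M i (inj_of_mono i h)) X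

lemma HR_rep (e : 𝟭 _ ⟶ D ⋙ F) (he : ∀ M i, Function.Injective (Rep.Hom.f (e.app M) i))
    (P : ℕ → Rep k n (ZQ n Q) → Prop) (m : ℕ) (h0 : ∀ M, P 0 M)
    (hm : ∀ M, P m M → ∀ i, Subsingleton (M.X i))
    (hs : ∀ (c : ℕ) (N M : Rep k n (ZQ n Q)) (i : F.obj (D.obj M) ⟶ N),
      (∀ v, Function.Surjective (i.f v)) → e.app M ≫ i = 0 → P c M → P (c + 1) N)
    (X : CochainComplex (ModuleCat.{0} (AQ k n Q)ᵐᵒᵖ) ℤ) : HR (F ⋙ L hQ) X := by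
  have := inv_additive (k := k) hQ
  exact HR_abs F D (L hQ) (L hQ).inv (fun M => (L hQ).asEquivalence.counitIso.app M)
    (fun f => (L hQ).asEquivalence.counitIso.hom.naturality f) e (fun M => mono_L_map _ (he M))
    P m h0 (fun M h => isZero_L (hm M h)) (fun c N M i h => hs c N M i (surj_of_epi i h)) X

omit [HasZeroObject E] [HasBinaryBiproducts E] [F.Full] [F.Faithful] in
lemma acyclic_rep (Y : CochainComplex E ℤ) :
    (((F ⋙ L hQ).mapHomologicalComplex _).obj Y).Acyclic ↔
      ∀ (a b c : ℤ), a + 1 = b → b + 1 = c → ∀ (w : Fin n) (x : (F.obj (Y.X b)).X w),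
        Rep.Hom.f (F.map (Y.d b c)) w x = 0 → ∃ y, Rep.Hom.f (F.map (Y.d a b)) w y = x := by
  have key : ∀ a b c : ℤ, a + 1 = b → b + 1 = c →
      ((((F ⋙ L hQ).mapHomologicalComplex _).obj Y).ExactAt b ↔
      ∀ (w : Fin n) (x : (F.obj (Y.X b)).X w),
        Rep.Hom.f (F.map (Y.d b c)) w x = 0 → ∃ y, Rep.Hom.f (F.map (Y.d a b)) w y = x) := by
    intro a b c hab hbc
    rw [HomologicalComplex.exactAt_iff' _ a b c (by simp [← hab]) (by simp [hbc]),
      ShortComplex.moduleCat_exact_iff]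
    constructor
    · intro h w x hx
      obtain ⟨y, hy⟩ := h (Pi.single w x : ∀ i, (F.obj (Y.X b)).X i) (by
        refine (single_map (F.map (Y.d b c)) w x).trans ?_
        rw [hx]; exact Pi.single_zero _)
      refine ⟨(y : ∀ i, (F.obj (Y.X a)).X i) w, ?_⟩
      have := congrFun hy w
      rw [Pi.single_eq_same] at this
      exact this
    · intro h x hx
      choose y hy using fun w => h w ((x : ∀ i, (F.obj (Y.X b)).X i) w) (congrFun hx w)
      exact ⟨y, funext hy⟩
  constructor
  · intro h a b c hab hbc
    exact (key a b c hab hbc).1 (h b)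
  · intro h b
    exact (key (b - 1) b (b + 1) (by simp) rfl).2 (h _ _ _ (by simp) rfl)

end Pack
end NakDer
end

section
namespace NakDer
open CategoryTheory Category Limits

/-- combinatorial data for the intermediate category -/
structure Dat (n : ℕ) where
  p : Fin n
  Z : Fin n → Fin n → Prop
  NE : Fin n → Fin n → Prop
  le : ∀ {a b}, NE a b → a ≤ b
  sub : ∀ {a b c e}, NE a b → a ≤ c → c ≤ e → e ≤ b → NE c e
  refl : ∀ a, NE a a
  tail : ∀ {a b}, NE a b → p < b → a = b

/-- objects of the intermediate category -/
structure EObj (k : Type) [Field k] {n : ℕ} (d : Dat n) where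
  rep : Rep k n d.Z

namespace EObj
variable {k : Type} [Field k] {n : ℕ} {d : Dat n}

/-- components -/
abbrev X (M : EObj k d) (i : Fin n) : Type := M.rep.X i

/-- morphisms of the intermediate category -/
@[ext] structure Hom (M N : EObj k d) where
  f : ∀ i j, M.X i →ₗ[k] N.X j
  supp : ∀ i j, ¬ d.NE j i → f i j = 0
  comm : ∀ i j (h : i ≤ j), d.p ≤ i → ∀ x, f j j (M.rep.map i j h x) = N.rep.map i j h (f i i x)

lemma Hom.supp' {M N : EObj k d} (φ : Hom M N) {i j} (h : ¬ d.NE j i) (x) : φ.f i j x = 0 := by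
  rw [φ.supp i j h]; rfl

open Classical in
/-- composition coefficients -/
noncomputable def cmp {M N P : EObj k d} (φ : Hom M N) (ψ : Hom N P) (i l : Fin n) :
    M.X i →ₗ[k] P.X l :=
  if d.NE l i then ∑ j, (ψ.f j l).comp (φ.f i j) else 0

lemma cmp_apply {M N P : EObj k d} (φ : Hom M N) (ψ : Hom N P) {i l : Fin n} (h : d.NE l i) (x) :
    cmp φ ψ i l x = ∑ j, ψ.f j l (φ.f i j x) := by
  rw [cmp, if_pos h]; simp

lemma cmp_apply_ne {M N P : EObj k d} (φ : Hom M N) (ψ : Hom N P) {i l : Fin n} (h : ¬ d.NE l i)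
    (x) : cmp φ ψ i l x = 0 := by
  rw [cmp, if_neg h]; simp

lemma cmp_diag {M N P : EObj k d} (φ : Hom M N) (ψ : Hom N P) (i : Fin n) (x) :
    cmp φ ψ i i x = ψ.f i i (φ.f i i x) := by
  rw [cmp_apply _ _ (d.refl i), Finset.sum_eq_single i]
  · intro j _ hj
    by_cases h : d.NE j i
    · by_cases h' : d.NE i j
      · exact absurd (le_antisymm (d.le h) (d.le h')) hj
      · exact ψ.supp' h' _
    · rw [φ.supp' h, map_zero]
  · simp

lemma Hom.ext' {M N : EObj k d} {φ ψ : Hom M N} (h : ∀ i j, d.NE j i → ∀ x, φ.f i j x = ψ.f i j x) :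
    φ = ψ := by
  refine Hom.ext (funext fun i => funext fun j => LinearMap.ext fun x => ?_)
  by_cases hij : d.NE j i
  · exact h i j hij x
  · rw [φ.supp' hij, ψ.supp' hij]

open Classical in
/-- diagonal morphism -/
noncomputable def dg {M N : EObj k d} (g : ∀ i, M.X i →ₗ[k] N.X i) (i j : Fin n) :
    M.X i →ₗ[k] N.X j :=
  if h : i = j then h ▸ g i else 0

@[simp] lemma dg_self {M N : EObj k d} (g : ∀ i, M.X i →ₗ[k] N.X i) (i : Fin n) :
  dg g i i = g i := by simp [dg]

lemma dg_ne {M N : EObj k d} (g : ∀ i, M.X i →ₗ[k] N.X i) {i j : Fin n} (h : i ≠ j) :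
  dg g i j = 0 := by simp [dg, h]

/-- diagonal morphism -/
noncomputable def dgHom {M N : EObj k d} (g : ∀ i, M.X i →ₗ[k] N.X i)
    (hg : ∀ i j (h : i ≤ j), d.p ≤ i → ∀ x, g j (M.rep.map i j h x) = N.rep.map i j h (g i x)) :
    Hom M N where
  f := dg g
  supp i j h := dg_ne g (by rintro rfl; exact h (d.refl i))
  comm i j h hp x := by simpa using hg i j h hp x

noncomputable instance : Category (EObj k d) where
  Hom := Hom
  id M := dgHom (fun i => LinearMap.id) (fun i j h hp x => rfl)
  comp φ ψ :=
    { f := cmp φ ψ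
      supp := fun i j h => LinearMap.ext fun x => cmp_apply_ne _ _ h x
      comm := fun i j h hp x => by
        rw [cmp_diag, cmp_diag, φ.comm i j h hp, ψ.comm i j h hp] }
  id_comp φ := Hom.ext' fun i j h x => by
    show cmp _ _ i j x = _
    rw [cmp_apply _ _ h, Finset.sum_eq_single i]
    · simp [dgHom]
    · intro l _ hl
      simp [dgHom, dg_ne _ hl.symm]
    · simp
  comp_id φ := Hom.ext' fun i j h x => by
    show cmp _ _ i j x = _
    rw [cmp_apply _ _ h, Finset.sum_eq_single j]
    · simp [dgHom]
    · intro l _ hl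
      simp [dgHom, dg_ne _ hl]
    · simp
  assoc φ ψ χ := Hom.ext' fun i m h x => by
    show cmp _ χ i m x = cmp φ _ i m x
    rw [cmp_apply _ _ h, cmp_apply _ _ h]
    show ∑ l, χ.f l m (cmp φ ψ i l x) = ∑ j, cmp ψ χ j m (φ.f i j x)
    have h1 : ∀ l, χ.f l m (cmp φ ψ i l x) = ∑ j, χ.f l m (ψ.f j l (φ.f i j x)) := by
      intro l
      rw [← map_sum]
      by_cases hml : d.NE m l
      · by_cases hli : d.NE l i
        · rw [cmp_apply _ _ hli]
        · rw [cmp_apply_ne _ _ hli, Finset.sum_eq_zero]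
          intro j _
          by_cases hji : d.NE j i
          · refine ψ.supp' (fun hlj => hli ?_) _
            exact d.sub h (d.le hml) ((d.le hlj).trans (d.le hji)) le_rfl
          · rw [φ.supp' hji, map_zero]
      · rw [χ.supp' hml, χ.supp' hml]
    have h2 : ∀ j, cmp ψ χ j m (φ.f i j x) = ∑ l, χ.f l m (ψ.f j l (φ.f i j x)) := by
      intro j
      by_cases hji : d.NE j i
      · by_cases hmj : d.NE m j
        · rw [cmp_apply _ _ hmj]
        · rw [cmp_apply_ne _ _ hmj, Finset.sum_eq_zero]
          intro l _
          by_cases hml : d.NE m l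
          · rw [ψ.supp', map_zero]
            intro hlj
            exact hmj (d.sub h le_rfl ((d.le hml).trans (d.le hlj)) (d.le hji))
          · exact χ.supp' hml _
      · simp [φ.supp' hji]
    simp only [h1, h2]
    exact Finset.sum_comm

lemma id_f_self (M : EObj k d) (i) (x : M.X i) : Hom.f (𝟙 M) i i x = x := by
  show dg _ i i x = x
  simp

lemma id_f_ne (M : EObj k d) {i j} (h : i ≠ j) (x : M.X i) : Hom.f (𝟙 M) i j x = 0 := by
  show dg _ i j x = 0
  simp [dg_ne _ h]

lemma comp_f {M N P : EObj k d} (φ : M ⟶ N) (ψ : N ⟶ P) {i l : Fin n} (h : d.NE l i) (x) :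
    Hom.f (φ ≫ ψ) i l x = ∑ j, ψ.f j l (φ.f i j x) := cmp_apply _ _ h x

lemma comp_f_self {M N P : EObj k d} (φ : M ⟶ N) (ψ : N ⟶ P) (i : Fin n) (x) :
    Hom.f (φ ≫ ψ) i i x = ψ.f i i (φ.f i i x) := cmp_diag _ _ i x

lemma hom_ext {M N : EObj k d} {φ ψ : M ⟶ N} (h : ∀ i j, d.NE j i → ∀ x, φ.f i j x = ψ.f i j x) :
    φ = ψ := Hom.ext' h

instance (M N : EObj k d) : Zero (M ⟶ N) :=
  ⟨⟨fun _ _ => 0, fun _ _ _ => rfl, fun i j h _ x => by simp⟩⟩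
instance (M N : EObj k d) : Add (M ⟶ N) :=
  ⟨fun f g => ⟨fun i j => f.f i j + g.f i j, fun i j h => by rw [f.supp i j h, g.supp i j h, add_zero],
    fun i j h hp x => by simp [f.comm i j h hp, g.comm i j h hp]⟩⟩
instance (M N : EObj k d) : Neg (M ⟶ N) :=
  ⟨fun f => ⟨fun i j => - f.f i j, fun i j h => by rw [f.supp i j h, neg_zero],
    fun i j h hp x => by simp [f.comm i j h hp]⟩⟩
@[simp] lemma zero_f (M N : EObj k d) (i j) (x : M.X i) : Hom.f (0 : M ⟶ N) i j x = 0 := rfl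
@[simp] lemma add_f {M N : EObj k d} (f g : M ⟶ N) (i j) (x : M.X i) :
  Hom.f (f + g) i j x = f.f i j x + g.f i j x := rfl
@[simp] lemma neg_f {M N : EObj k d} (f : M ⟶ N) (i j) (x : M.X i) :
  Hom.f (- f) i j x = - f.f i j x := rfl

instance (M N : EObj k d) : AddCommGroup (M ⟶ N) where
  add_assoc f g h := hom_ext fun i j _ x => by simp [add_assoc]
  zero_add f := hom_ext fun i j _ x => by simp
  add_zero f := hom_ext fun i j _ x => by simp
  add_comm f g := hom_ext fun i j _ x => by simp [add_comm]
  neg_add_cancel f := hom_ext fun i j _ x => by simp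
  nsmul := nsmulRec
  zsmul := zsmulRec

noncomputable instance : Preadditive (EObj k d) where
  add_comp P Q R f f' g := hom_ext fun i j h x => by
    simp [comp_f _ _ h, Finset.sum_add_distrib]
  comp_add P Q R f g g' := hom_ext fun i j h x => by
    simp [comp_f _ _ h, Finset.sum_add_distrib]

/-- The underlying object of the diagonal functor. -/
def diagObj {Z : Fin n → Fin n → Prop} (hZ : ∀ a b, d.Z a b → Z a b) (M : Rep k n Z) : EObj k d :=
  ⟨⟨M.X, M.map, M.map_id, M.map_comp, fun a b h hz => M.rel a b h (hZ a b hz)⟩⟩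

/-- The diagonal functor on morphisms. -/
noncomputable def diagMap {Z : Fin n → Fin n → Prop} (hZ : ∀ a b, d.Z a b → Z a b) {M N : Rep k n Z}
    (g : M ⟶ N) : diagObj hZ M ⟶ diagObj hZ N :=
  dgHom (M := diagObj hZ M) (N := diagObj hZ N) g.f (fun i j h _ x => g.comm i j h x)

lemma diagMap_self {Z : Fin n → Fin n → Prop} (hZ : ∀ a b, d.Z a b → Z a b) {M N : Rep k n Z}
    (g : M ⟶ N) (i : Fin n) (x : M.X i) : (diagMap hZ g).f i i x = g.f i x :=
  congrArg (fun (u : M.X i →ₗ[k] N.X i) => u x)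
    (dg_self (M := diagObj hZ M) (N := diagObj hZ N) g.f i)

lemma diagMap_ne {Z : Fin n → Fin n → Prop} (hZ : ∀ a b, d.Z a b → Z a b) {M N : Rep k n Z}
    (g : M ⟶ N) {i j : Fin n} (h : i ≠ j) (x : M.X i) : (diagMap hZ g).f i j x = 0 :=
  congrArg (fun (u : M.X i →ₗ[k] N.X j) => u x)
    (dg_ne (M := diagObj hZ M) (N := diagObj hZ N) g.f h)

lemma diag_ext {M N : EObj k d} {φ ψ : M ⟶ N} (h1 : ∀ i x, φ.f i i x = ψ.f i i x)
    (h2 : ∀ i j, i ≠ j → ∀ x, φ.f i j x = 0) (h3 : ∀ i j, i ≠ j → ∀ x, ψ.f i j x = 0) : φ = ψ :=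
  hom_ext fun i j _ x => by
    by_cases h : i = j
    · subst h; exact h1 i x
    · rw [h2 i j h, h3 i j h]

lemma comp_ne {M N P : EObj k d} {φ : M ⟶ N} {ψ : N ⟶ P} (h2 : ∀ i j, i ≠ j → ∀ x, φ.f i j x = 0)
    (h3 : ∀ i j, i ≠ j → ∀ x, ψ.f i j x = 0) (i j) (hij : i ≠ j) (x) : (φ ≫ ψ).f i j x = 0 := by
  by_cases h : d.NE j i
  · rw [comp_f _ _ h]
    refine Finset.sum_eq_zero fun l _ => ?_
    by_cases hl : i = l
    · subst hl; exact h3 _ _ hij _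
    · rw [h2 _ _ hl, map_zero]
  · exact Hom.supp' _ h x

/-- The diagonal functor. -/
noncomputable def diag {Z : Fin n → Fin n → Prop} (hZ : ∀ a b, d.Z a b → Z a b) :
    Rep k n Z ⥤ EObj k d where
  obj M := diagObj hZ M
  map g := diagMap hZ g
  map_id M := rfl
  map_comp {M N P} f g := diag_ext
    (fun i x => by
      rw [comp_f_self]
      refine (diagMap_self hZ (f ≫ g) i x).trans ?_
      refine Eq.trans ?_ (congrArg _ (diagMap_self hZ f i x)).symm
      exact (diagMap_self hZ g i (f.f i x)).symm)
    (fun i j h x => diagMap_ne hZ (f ≫ g) h x)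
    (comp_ne (fun i j h x => diagMap_ne hZ f h x) (fun i j h x => diagMap_ne hZ g h x))

instance {Z : Fin n → Fin n → Prop} (hZ : ∀ a b, d.Z a b → Z a b) :
    (diag (k := k) hZ).Additive where
  map_add {M N f g} := diag_ext
    (fun i x => by
      show (diagMap hZ (f + g)).f i i x = (diagMap hZ f).f i i x + (diagMap hZ g).f i i x
      refine (diagMap_self hZ (f + g) i x).trans ?_
      refine Eq.trans ?_ (congrArg₂ (· + ·) (diagMap_self hZ f i x).symm (diagMap_self hZ g i x).symm)
      rfl)
    (fun i j h x => diagMap_ne hZ (f + g) h x)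
    (fun i j h x => by
      show (diagMap hZ f).f i j x + (diagMap hZ g).f i j x = 0
      refine (congrArg₂ (· + ·) (diagMap_ne hZ f h x) (diagMap_ne hZ g h x)).trans ?_
      simp)

/-- The zero object. -/
def zeroObj : EObj k d :=
  ⟨⟨fun _ => PUnit, fun _ _ _ => 0, fun _ _ _ => rfl, fun _ _ _ _ _ _ => rfl, fun _ _ _ _ _ => rfl⟩⟩

instance : HasZeroObject (EObj k d) := by
  refine ⟨zeroObj, (IsZero.iff_id_eq_zero _).2 ?_⟩
  exact hom_ext fun i j h x => rfl

/-- product of representations -/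
def prodRep {Z : Fin n → Fin n → Prop} (M N : Rep k n Z) : Rep k n Z where
  X i := M.X i × N.X i
  map i j h := (M.map i j h).prodMap (N.map i j h)
  map_id i h x := by simp [M.map_id, N.map_id]
  map_comp i j l h h' x := by simp [M.map_comp, N.map_comp]
  rel a b h hz x := by simp [M.rel a b h hz, N.rel a b h hz]

instance {Z : Fin n → Fin n → Prop} : HasBinaryBiproducts (Rep k n Z) where
  has_binary_biproduct M N := by
    refine hasBinaryBiproduct_of_total
      { pt := prodRep M N
        fst := ⟨fun i => LinearMap.fst k _ _, fun i j h x => rfl⟩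
        snd := ⟨fun i => LinearMap.snd k _ _, fun i j h x => rfl⟩
        inl := ⟨fun i => LinearMap.inl k _ _, fun i j h x => Prod.ext rfl (map_zero (N.map i j h)).symm⟩
        inr := ⟨fun i => LinearMap.inr k _ _, fun i j h x => Prod.ext (map_zero (M.map i j h)).symm rfl⟩
        inl_fst := rfl
        inr_snd := rfl
        inl_snd := rfl
        inr_fst := rfl } ?_
    exact Rep.hom_ext fun i x => by
      refine Prod.ext ?_ ?_
      · exact add_zero _
      · exact zero_add _

instance : HasBinaryBiproducts (EObj k d) where
  has_binary_biproduct M N := by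
    let D := diag (k := k) (d := d) (Z := d.Z) (fun _ _ h => h)
    have : HasBinaryBiproduct (D.obj M.rep) (D.obj N.rep) := by
      let b := D.mapBinaryBicone (BinaryBiproduct.bicone M.rep N.rep)
      refine hasBinaryBiproduct_of_total b ?_
      have h := congrArg D.map (biprod.total (X := M.rep) (Y := N.rep))
      rw [D.map_add, D.map_comp, D.map_comp, D.map_id] at h
      exact h
    exact this

end EObj
end NakDer
end

section
namespace NakDer
open CategoryTheory Category Limits

/-- Families of intervals defining a functor out of the intermediate category. -/
structure Fam {n : ℕ} (d : Dat n) (Zt : Fin n → Fin n → Prop) where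
  S : Fin n → Fin n → Prop
  s0 : ∀ i, S i i
  sleft : ∀ {w i}, S w i → w ≤ d.p → i ≤ d.p
  stail : ∀ {w i}, S w i → d.p < w → i = w
  sconv : ∀ {w w' w'' i}, w ≤ w' → w' ≤ w'' → S w i → S w'' i → S w' i
  s1 : ∀ {w i j}, S w i → S w j → j ≤ i → d.NE j i
  s2 : ∀ {w i j l}, S w i → S w l → l ≤ j → j ≤ i → S w j
  s3 : ∀ {w w' i j}, w ≤ w' → w' ≤ d.p → S w i → S w' j → d.NE j i → (S w' i ↔ S w j)
  s4 : ∀ {i j}, d.NE j i → ∃ w, S w i ∧ S w j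
  s5 : ∀ {w i j}, w ≤ d.p → S w i → S w j → i < j →
    (∃ u, u ≤ w ∧ S u i ∧ ¬ S u j) ∨ (∃ u, w ≤ u ∧ u ≤ d.p ∧ S u j ∧ ¬ S u i)
  ρ : Fin n → ℕ
  s6 : ∀ {i j}, S i j → j ≠ i → ρ j < ρ i
  zt : ∀ {a b}, Zt a b → a ≤ b → (b ≤ d.p ∧ ∀ i, ¬ (S a i ∧ S b i)) ∨
    (d.p < b ∧ a ≤ d.p ∧ ¬ S a d.p) ∨ (d.p < b ∧ d.Z (max d.p a) b)

/-- good subsets -/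
def GoodT {n : ℕ} (d : Dat n) (T : Fin n → Prop) : Prop :=
  (∀ i j, T i → T j → j ≤ i → d.NE j i) ∧ (∀ i j l, T i → T l → l ≤ j → j ≤ i → T j)

lemma Fam.good {n : ℕ} {d : Dat n} {Zt} (s : Fam d Zt) (w) : GoodT d (s.S w) :=
  ⟨fun _ _ h h' => s.s1 h h', fun _ _ _ h h' => s.s2 h h'⟩

namespace EObj
variable {k : Type} [Field k] {n : ℕ} {d : Dat n}

/-- vectors supported on `T` -/
def supp (M : EObj k d) (T : Fin n → Prop) : Submodule k (∀ i, M.X i) where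
  carrier := {x | ∀ i, ¬ T i → x i = 0}
  add_mem' := fun {a b} ha hb i h => by simp [ha i h, hb i h]
  zero_mem' := fun i h => rfl
  smul_mem' := fun c x hx i h => by simp [hx i h]

lemma supp_or {M : EObj k d} {T : Fin n → Prop} {x} (hx : x ∈ M.supp T) (i) : T i ∨ x i = 0 := by
  by_cases h : T i
  · exact .inl h
  · exact .inr (hx i h)

lemma single_mem {M : EObj k d} {T : Fin n → Prop} {i} (h : T i) (x : M.X i) :
    (Pi.single i x : ∀ i, M.X i) ∈ M.supp T := fun j hj => by
  rw [Pi.single_eq_of_ne]; rintro rfl; exact hj h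

open Classical in
/-- total map -/
noncomputable def dT {M N : EObj k d} (φ : M ⟶ N) (T : Fin n → Prop) :
    (∀ i, M.X i) →ₗ[k] (∀ i, N.X i) :=
  LinearMap.pi fun j => if T j then ∑ i, (φ.f i j).comp (LinearMap.proj i) else 0

lemma dT_apply {M N : EObj k d} (φ : M ⟶ N) {T : Fin n → Prop} (x) {j} (h : T j) :
    dT φ T x j = ∑ i, φ.f i j (x i) := by
  simp [dT, h]

lemma dT_apply_ne {M N : EObj k d} (φ : M ⟶ N) {T : Fin n → Prop} (x) {j} (h : ¬ T j) :
    dT φ T x j = 0 := by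
  simp [dT, h]

lemma dT_mem {M N : EObj k d} (φ : M ⟶ N) (T : Fin n → Prop) (x) : dT φ T x ∈ N.supp T :=
  fun _ h => dT_apply_ne φ x h

lemma dT_single {M N : EObj k d} (φ : M ⟶ N) {T : Fin n → Prop} (i) (x : M.X i) {j} (h : T j) :
    dT φ T (Pi.single i x) j = φ.f i j x := by
  rw [dT_apply _ _ h, Finset.sum_eq_single i]
  · simp
  · intro l _ hl; simp [Pi.single_eq_of_ne hl]
  · simp

lemma dT_id (M : EObj k d) {T : Fin n → Prop} {x} (hx : x ∈ M.supp T) : dT (𝟙 M) T x = x := by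
  funext j
  by_cases h : T j
  · rw [dT_apply _ _ h, Finset.sum_eq_single j]
    · exact id_f_self M j _
    · intro l _ hl; exact id_f_ne M hl _
    · simp
  · rw [dT_apply_ne _ _ h, hx j h]

lemma dT_comp {M N P : EObj k d} (φ : M ⟶ N) (ψ : N ⟶ P) {T : Fin n → Prop} (hT : GoodT d T)
    {x} (hx : x ∈ M.supp T) : dT (φ ≫ ψ) T x = dT ψ T (dT φ T x) := by
  classical
  funext l
  by_cases h : T l
  · rw [dT_apply _ _ h, dT_apply _ _ h]
    have h1 : ∀ j, ψ.f j l (dT φ T x j) = ∑ i, ψ.f j l (if T j then φ.f i j (x i) else 0) := by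
      intro j
      by_cases hj : T j
      · rw [dT_apply _ _ hj]; simp [hj]
      · rw [dT_apply_ne _ _ hj]; simp [hj]
    simp only [h1]
    rw [Finset.sum_comm]
    refine Finset.sum_congr rfl fun i _ => ?_
    obtain hi | hi := supp_or hx i
    · by_cases hl : d.NE l i
      · rw [comp_f _ _ hl]
        refine Finset.sum_congr rfl fun j _ => ?_
        by_cases hj : T j
        · simp [hj]
        · simp only [hj, if_false, map_zero]
          by_cases h1 : d.NE l j
          · by_cases h2 : d.NE j i
            · exact absurd (hT.2 i j l hi h (d.le h1) (d.le h2)) hj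
            · rw [φ.supp' h2, map_zero]
          · exact ψ.supp' h1 _
      · rw [Hom.supp' _ hl, eq_comm]
        refine Finset.sum_eq_zero fun j _ => ?_
        by_cases h1 : d.NE l j
        · by_cases h2 : d.NE j i
          · exact absurd (hT.1 i l hi h ((d.le h1).trans (d.le h2))) hl
          · rw [φ.supp' h2]; simp
        · exact ψ.supp' h1 _
    · simp [hi]
  · rw [dT_apply_ne _ _ h, dT_apply_ne _ _ h]

lemma dT_zero (M N : EObj k d) (T : Fin n → Prop) (x) : dT (0 : M ⟶ N) T x = 0 := by
  funext j
  by_cases h : T j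
  · rw [dT_apply _ _ h]; simp
  · rw [dT_apply_ne _ _ h]; rfl

lemma dT_add {M N : EObj k d} (φ ψ : M ⟶ N) (T : Fin n → Prop) (x) :
    dT (φ + ψ) T x = dT φ T x + dT ψ T x := by
  funext j
  by_cases h : T j
  · rw [Pi.add_apply, dT_apply _ _ h, dT_apply _ _ h, dT_apply _ _ h]; simp [Finset.sum_add_distrib]
  · rw [Pi.add_apply, dT_apply_ne _ _ h, dT_apply_ne _ _ h, dT_apply_ne _ _ h]; simp

variable {Zt : Fin n → Fin n → Prop} (s : Fam d Zt)

open Classical in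
/-- transition maps -/
noncomputable def mT (M : EObj k d) (w w' : Fin n) (h : w ≤ w') :
    (∀ i, M.X i) →ₗ[k] (∀ i, M.X i) :=
  if hp : w' ≤ d.p then LinearMap.pi fun i => if s.S w' i then LinearMap.proj i else 0
  else (LinearMap.single k M.X w').comp
    ((M.rep.map (max d.p w) w' (max_le (not_le.1 hp).le h)).comp (LinearMap.proj (max d.p w)))

open Classical in
lemma mT_le (M : EObj k d) {w w' : Fin n} (h : w ≤ w') (hp : w' ≤ d.p) (x) (i) :
    mT s M w w' h x i = if s.S w' i then x i else 0 := by
  rw [mT, dif_pos hp]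
  by_cases hi : s.S w' i <;> simp [hi]

lemma mT_gt (M : EObj k d) {w w' : Fin n} (h : w ≤ w') (hp : d.p < w') (x) (m) (hm : m = max d.p w)
    (hmw : m ≤ w') : mT s M w w' h x = Pi.single w' (M.rep.map m w' hmw (x m)) := by
  subst hm
  rw [mT, dif_neg (not_le.2 hp)]
  rfl

lemma mT_mem (M : EObj k d) {w w' : Fin n} (h : w ≤ w') (x) : mT s M w w' h x ∈ M.supp (s.S w') := by
  obtain hp | hp := le_or_gt w' d.p
  · intro i hi
    rw [mT_le s M h hp, if_neg hi]
  · rw [mT_gt s M h hp x _ rfl (max_le hp.le h)]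
    exact single_mem (s.s0 w') _

lemma mT_id (M : EObj k d) {w : Fin n} (h : w ≤ w) {x} (hx : x ∈ M.supp (s.S w)) :
    mT s M w w h x = x := by
  obtain hp | hp := le_or_gt w d.p
  · funext i
    rw [mT_le s M h hp]
    split_ifs with hi
    · rfl
    · rw [hx i hi]
  · rw [mT_gt s M h hp x w (max_eq_right hp.le).symm le_rfl, M.rep.map_id]
    funext i
    by_cases hi : i = w
    · subst hi; simp
    · rw [Pi.single_eq_of_ne hi, hx i (fun h => hi (s.stail h hp))]

lemma mT_comp (M : EObj k d) {w w' w'' : Fin n} (h : w ≤ w') (h' : w' ≤ w'') {x}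
    (hx : x ∈ M.supp (s.S w)) :
    mT s M w' w'' h' (mT s M w w' h x) = mT s M w w'' (h.trans h') x := by
  obtain hp | hp := le_or_gt w'' d.p
  · funext i
    rw [mT_le s M _ hp, mT_le s M _ (h'.trans hp), mT_le s M _ hp]
    by_cases h1 : s.S w'' i
    · rw [if_pos h1, if_pos h1]
      split_ifs with h2
      · rfl
      · rw [hx i (fun h3 => h2 (s.sconv h h' h3 h1))]
    · rw [if_neg h1, if_neg h1]
  · obtain hp' | hp' := le_or_gt w' d.p
    · rw [mT_gt s M h' hp _ d.p (max_eq_left hp').symm hp.le,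
        mT_gt s M (h.trans h') hp _ d.p (max_eq_left (h.trans hp')).symm hp.le,
        mT_le s M _ hp']
      congr 2
      split_ifs with h2
      · rfl
      · rw [hx d.p (fun h3 => h2 (s.sconv h hp' h3 (s.s0 _)))]
    · rw [mT_gt s M h' hp _ w' (max_eq_right hp'.le).symm h',
        mT_gt s M (h.trans h') hp _ _ rfl (max_le hp.le (h.trans h')),
        mT_gt s M h hp' _ _ rfl (max_le hp'.le h), Pi.single_eq_same, M.rep.map_comp]

lemma mT_rel (M : EObj k d) {a b : Fin n} (h : a ≤ b) (hz : Zt a b) {x}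
    (hx : x ∈ M.supp (s.S a)) : mT s M a b h x = 0 := by
  obtain ⟨hp, h1⟩ | ⟨hp, ha, h1⟩ | ⟨hp, h1⟩ := s.zt hz h
  · funext i
    rw [mT_le s M _ hp]
    split_ifs with h2
    · exact hx i (fun h3 => h1 i ⟨h3, h2⟩)
    · rfl
  · rw [mT_gt s M h hp _ d.p (max_eq_left ha).symm hp.le, hx _ h1, map_zero, Pi.single_zero]
  · rw [mT_gt s M h hp _ _ rfl (max_le hp.le h), M.rep.rel _ _ _ h1, Pi.single_zero]

lemma dT_mT {M N : EObj k d} (φ : M ⟶ N) {w w' : Fin n} (h : w ≤ w') {x}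
    (hx : x ∈ M.supp (s.S w)) :
    dT φ (s.S w') (mT s M w w' h x) = mT s N w w' h (dT φ (s.S w) x) := by
  obtain hp | hp := le_or_gt w' d.p
  · funext j
    rw [mT_le s N h hp]
    split_ifs with hj
    · rw [dT_apply _ _ hj]
      by_cases hw : s.S w j
      · rw [dT_apply _ _ hw]
        refine Finset.sum_congr rfl fun i _ => ?_
        rw [mT_le s M h hp]
        split_ifs with hi
        · rfl
        · obtain h1 | h1 := supp_or hx i
          · by_cases h2 : d.NE j i
            · exact absurd ((s.s3 h hp h1 hj h2).2 hw) hi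
            · rw [φ.supp' h2, φ.supp' h2]
          · rw [h1]
      · rw [dT_apply_ne _ _ hw]
        refine Finset.sum_eq_zero fun i _ => ?_
        rw [mT_le s M h hp]
        split_ifs with hi
        · obtain h1 | h1 := supp_or hx i
          · by_cases h2 : d.NE j i
            · exact absurd ((s.s3 h hp h1 hj h2).1 hi) hw
            · rw [φ.supp' h2]
          · rw [h1, map_zero]
        · rw [map_zero]
    · rw [dT_apply_ne _ _ hj]
  · obtain ⟨m, hm⟩ : ∃ m, m = max d.p w := ⟨_, rfl⟩
    have hmw : m ≤ w' := hm ▸ max_le hp.le h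
    have hpm : d.p ≤ m := hm ▸ le_max_left _ _
    rw [mT_gt s M h hp _ m hm hmw, mT_gt s N h hp _ m hm hmw]
    have key : dT φ (s.S w) x m = φ.f m m (x m) := by
      by_cases hs : s.S w m
      · rw [dT_apply _ _ hs, Finset.sum_eq_single m]
        · intro i _ hi
          obtain h1 | h1 := supp_or hx i
          · refine φ.supp' (fun h2 => hi (le_antisymm ?_ (d.le h2))) _
            obtain hw | hw := le_or_gt w d.p
            · exact (s.sleft h1 hw).trans hpm
            · rw [s.stail h1 hw, hm]; exact le_max_right _ _
          · rw [h1, map_zero]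
        · simp
      · rw [dT_apply_ne _ _ hs, hx m hs, map_zero]
    rw [key]
    funext j
    by_cases hj : j = w'
    · subst hj
      rw [dT_single _ _ _ (s.s0 j), φ.comm _ _ _ hpm, Pi.single_eq_same]
    · rw [dT_apply_ne _ _ (fun h => hj (s.stail h hp)), Pi.single_eq_of_ne hj]

/-- The functor on objects. -/
noncomputable def FObj (M : EObj k d) : Rep k n Zt where
  X w := M.supp (s.S w)
  map w w' h := (mT s M w w' h).restrict (fun x _ => mT_mem s M h x)
  map_id w h x := Subtype.ext (mT_id s M h x.2)
  map_comp i j l hij hjl x := Subtype.ext (mT_comp s M hij hjl x.2)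
  rel a b h hz x := Subtype.ext (mT_rel s M h hz x.2)

/-- The functor attached to a family of intervals. -/
noncomputable def Fun : EObj k d ⥤ Rep k n Zt where
  obj M := FObj s M
  map φ := ⟨fun w => (dT φ (s.S w)).restrict (fun x _ => dT_mem φ _ x),
    fun i j h x => Subtype.ext (dT_mT s φ h x.2)⟩
  map_id M := Rep.hom_ext fun w x => Subtype.ext (dT_id M x.2)
  map_comp φ ψ := Rep.hom_ext fun w x => Subtype.ext (dT_comp φ ψ (s.good w) x.2)

instance : (Fun (k := k) s).Additive where
  map_add {M N φ ψ} := Rep.hom_ext fun w x => Subtype.ext (dT_add φ ψ _ x.1)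

lemma Fun_map_val {M N : EObj k d} (φ : M ⟶ N) (w) (x : ((Fun s).obj M).X w) :
    (((Fun s).map φ).f w x).1 = dT φ (s.S w) x.1 := rfl

instance : (Fun (k := k) s).Faithful where
  map_injective {M N φ ψ} h := hom_ext fun i j hij x => by
    obtain ⟨w, hi, hj⟩ := s.s4 hij
    have : dT φ (s.S w) (Pi.single i x) j = dT ψ (s.S w) (Pi.single i x) j := congrArg (fun u : (Fun s).obj M ⟶ (Fun s).obj N =>
      (u.f w ⟨Pi.single i x, single_mem hi x⟩).1 j) h
    rwa [dT_single _ _ _ hj, dT_single _ _ _ hj] at this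

end EObj
end NakDer
end

section
namespace NakDer
open CategoryTheory Category Limits

namespace EObj
variable {k : Type} [Field k] {n : ℕ} {d : Dat n}
variable {Zt : Fin n → Fin n → Prop} (s : Fam d Zt)

lemma val_ext {M : EObj k d} {w} {x y : ((Fun s).obj M).X w} (h : ∀ i, x.1 i = y.1 i) : x = y :=
  Subtype.ext (funext h)

open Classical in
lemma map_val_le (M : EObj k d) {w w' : Fin n} (h : w ≤ w') (hp : w' ≤ d.p)
    (y : ((Fun s).obj M).X w) (i) :
    (((Fun s).obj M).map w w' h y).1 i = if s.S w' i then y.1 i else 0 := mT_le s M h hp y.1 i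

lemma map_val_gt (M : EObj k d) {w w' : Fin n} (h : w ≤ w') (hp : d.p < w')
    (y : ((Fun s).obj M).X w) (m) (hm : m = max d.p w) (hmw : m ≤ w') :
    (((Fun s).obj M).map w w' h y).1 = Pi.single w' (M.rep.map m w' hmw (y.1 m)) :=
  mT_gt s M h hp y.1 m hm hmw

lemma zero_val (M : EObj k d) (w i) : (0 : ((Fun s).obj M).X w).1 i = 0 := rfl

/-- inclusion of a component -/
noncomputable def inc (M : EObj k d) {w i : Fin n} (h : s.S w i) : M.X i →ₗ[k] ((Fun s).obj M).X w :=
  (LinearMap.single k M.X i).codRestrict (M.supp (s.S w)) (fun x => single_mem h x)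

lemma inc_val (M : EObj k d) {w i : Fin n} (h : s.S w i) (x : M.X i) :
    (inc s M h x).1 = Pi.single i x := rfl

/-- component of a supported vector -/
noncomputable def prj (M : EObj k d) (w i : Fin n) : ((Fun s).obj M).X w →ₗ[k] M.X i :=
  (LinearMap.proj i).comp (M.supp (s.S w)).subtype

lemma prj_val (M : EObj k d) (w i : Fin n) (x : ((Fun s).obj M).X w) : prj s M w i x = x.1 i := rfl

lemma sum_inc (M : EObj k d) (w : Fin n) (x : ((Fun s).obj M).X w) [DecidablePred (s.S w)] :
    x = ∑ i, if h : s.S w i then inc s M h (x.1 i) else 0 := by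
  refine Subtype.ext ?_
  have h1 : ∀ y : ((Fun s).obj M).X w, y.1 = (M.supp (s.S w)).subtype y := fun _ => rfl
  refine Eq.trans ?_ (h1 _).symm
  refine Eq.trans ?_ (map_sum _ _ _).symm
  have h2 : ∀ i, (M.supp (s.S w)).subtype (if h : s.S w i then inc s M h (x.1 i) else 0)
      = Pi.single i (x.1 i) := by
    intro i
    by_cases h : s.S w i
    · refine (congrArg _ (dif_pos h)).trans rfl
    · refine (congrArg _ (dif_neg h)).trans ?_
      have : x.1 i = 0 := x.2 i h
      rw [this, Pi.single_zero]; rfl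
  refine Eq.trans ?_ (Finset.sum_congr rfl fun i _ => (h2 i).symm)
  exact (Finset.univ_sum_single x.1).symm

open Classical in
/-- matrix coefficients of a morphism -/
noncomputable def GG {M N : EObj k d} (g : (Fun s).obj M ⟶ (Fun s).obj N) (w i j : Fin n) :
    M.X i →ₗ[k] N.X j :=
  if h : s.S w i then (prj s N w j).comp ((g.f w).comp (inc s M h)) else 0

variable {M N : EObj k d} (g : (Fun s).obj M ⟶ (Fun s).obj N)

lemma GG_apply {w i} (h : s.S w i) (j) (x : M.X i) :
    GG s g w i j x = (g.f w (inc s M h x)).1 j := by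
  rw [GG, dif_pos h]; rfl

lemma GG_ne {w i} (h : ¬ s.S w i) (j) (x : M.X i) : GG s g w i j x = 0 := by
  rw [GG, dif_neg h]; rfl

lemma GG_ne' {w j} (h : ¬ s.S w j) (i) (x : M.X i) : GG s g w i j x = 0 := by
  by_cases hi : s.S w i
  · rw [GG_apply s g hi]
    exact (g.f w (inc s M hi x)).2 j h
  · exact GG_ne s g hi j x

lemma g_eq (w j) (x : ((Fun s).obj M).X w) :
    (g.f w x).1 j = ∑ i, GG s g w i j (x.1 i) := by
  classical
  have h1 : (g.f w x).1 j = (prj s N w j) (g.f w x) := rfl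
  rw [h1]
  conv_lhs => rw [sum_inc s M w x]
  rw [map_sum, map_sum]
  refine Finset.sum_congr rfl fun i _ => ?_
  by_cases h : s.S w i
  · rw [dif_pos h, GG_apply s g h]; rfl
  · rw [dif_neg h, GG_ne s g h, map_zero, map_zero]

lemma GG_a {w w' i j} (h : w ≤ w') (hp : w' ≤ d.p) (hi : s.S w i) (hj : s.S w' j) (x : M.X i) :
    GG s g w i j x = GG s g w' i j x := by
  have h1 := congrArg (fun y => y.1 j) (g.comm w w' h (inc s M hi x))
  have h2 : (((Fun s).obj N).map w w' h (g.f w (inc s M hi x))).1 j = GG s g w i j x := by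
    refine (map_val_le s N h hp _ j).trans ?_
    rw [if_pos hj, GG_apply s g hi]
  have h3 : (g.f w' (((Fun s).obj M).map w w' h (inc s M hi x))).1 j = GG s g w' i j x := by
    by_cases hi' : s.S w' i
    · rw [GG_apply s g hi']
      refine congrArg (fun y => (g.f w' y).1 j) (val_ext s fun l => ?_)
      refine (map_val_le s M h hp _ l).trans ?_
      by_cases hl : l = i
      · subst hl; rw [if_pos hi']; rfl
      · rw [inc_val, inc_val, Pi.single_eq_of_ne hl]; simp
    · rw [GG_ne s g hi']
      have : ((Fun s).obj M).map w w' h (inc s M hi x) = 0 := by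
        refine val_ext s fun l => ?_
        refine (map_val_le s M h hp _ l).trans ?_
        by_cases hl : l = i
        · subst hl; rw [if_neg hi']; rfl
        · rw [inc_val, Pi.single_eq_of_ne hl, ite_self]; rfl
      rw [this, map_zero]; rfl
  exact h2.symm.trans (h1.symm.trans h3)

lemma GG_indep {w w' i j} (hi : s.S w i) (hj : s.S w j) (hi' : s.S w' i) (hj' : s.S w' j)
    (x : M.X i) : GG s g w i j x = GG s g w' i j x := by
  obtain hw | hw := le_or_gt w d.p
  · obtain hw' | hw' := le_or_gt w' d.p
    · obtain h | h := le_total w w'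
      · exact GG_a s g h hw' hi hj' x
      · exact (GG_a s g h hw hi' hj x).symm
    · have h1 := s.stail hi' hw'
      have h2 := s.sleft hi hw
      exact absurd (h1 ▸ hw') (not_lt.2 h2)
  · have h1 := s.stail hi hw
    obtain hw' | hw' := le_or_gt w' d.p
    · have h2 := s.sleft hi' hw'
      exact absurd (h1 ▸ hw) (not_lt.2 h2)
    · have h2 := s.stail hi' hw'
      have : w = w' := h1.symm.trans h2
      subst this; rfl

lemma GG_c {w i j} (hi : s.S w i) (hj : s.S w j) (h : ¬ d.NE j i) (x : M.X i) :
    GG s g w i j x = 0 := by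
  have hij : i < j := by
    by_contra h1
    exact h (s.s1 hi hj (not_lt.1 h1))
  have hw : w ≤ d.p := by
    by_contra h1
    have h1 := not_le.1 h1
    have := (s.stail hi h1).trans (s.stail hj h1).symm
    exact hij.ne this
  obtain ⟨u, hu, h1, h2⟩ | ⟨u, hu, hup, h1, h2⟩ := s.s5 hw hi hj hij
  · rw [← GG_a s g hu hw h1 hj, GG_ne' s g h2]
  · rw [GG_a s g hu hup hi h1, GG_ne s g h2]

open Classical in
/-- the preimage of a morphism -/
noncomputable def preim : M ⟶ N where
  f i j := if h : d.NE j i then GG s g (s.s4 h).choose i j else 0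
  supp i j h := by rw [dif_neg h]
  comm i i' h hp x := by
    have hd : ∀ i (x : M.X i), (if h : d.NE i i then GG s g (s.s4 h).choose i i else 0 : _ →ₗ[k] _) x
        = GG s g i i i x := by
      intro i x
      rw [dif_pos (d.refl i)]
      have := (s.s4 (d.refl i)).choose_spec
      exact GG_indep s g this.1 this.2 (s.s0 i) (s.s0 i) x
    rw [hd, hd]
    obtain rfl | hlt := eq_or_lt_of_le h
    · rw [M.rep.map_id, N.rep.map_id]
    have hp' : d.p < i' := lt_of_le_of_lt hp hlt
    have h1 := congrArg (fun y => y.1 i') (g.comm i i' h (inc s M (s.s0 i) x))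
    have h2 : (((Fun s).obj N).map i i' h (g.f i (inc s M (s.s0 i) x))).1 i'
        = N.rep.map i i' h (GG s g i i i x) := by
      refine (congrFun (map_val_gt s N h hp' _ i (max_eq_right hp).symm h) i').trans ?_
      rw [Pi.single_eq_same, GG_apply s g (s.s0 i)]
    have h3 : (g.f i' (((Fun s).obj M).map i i' h (inc s M (s.s0 i) x))).1 i'
        = GG s g i' i' i' (M.rep.map i i' h x) := by
      rw [GG_apply s g (s.s0 i')]
      refine congrArg (fun y => (g.f i' y).1 i') (Subtype.ext ?_)
      refine (map_val_gt s M h hp' _ i (max_eq_right hp).symm h).trans ?_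
      rw [inc_val, inc_val, Pi.single_eq_same]
    exact h3.symm.trans (h1.trans h2)

instance : (Fun (k := k) s).Full where
  map_surjective {M N} g := ⟨preim s g, Rep.hom_ext fun w x => val_ext s fun j => by
    rw [g_eq s g, Fun_map_val]
    by_cases hj : s.S w j
    · rw [dT_apply _ _ hj]
      refine Finset.sum_congr rfl fun i _ => ?_
      obtain h1 | h1 := supp_or x.2 i
      · by_cases h : d.NE j i
        · have h2 : (preim s g).f i j = GG s g (s.s4 h).choose i j := dif_pos h
          rw [h2]
          have := (s.s4 h).choose_spec
          exact GG_indep s g this.1 this.2 h1 hj _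
        · rw [Hom.supp' _ h, GG_c s g h1 hj h]
      · rw [h1, map_zero, map_zero]
    · rw [dT_apply_ne _ _ hj, Finset.sum_eq_zero]
      intro i _
      exact GG_ne' s g hj i _⟩

end EObj
end NakDer
end

section
namespace NakDer
open CategoryTheory Category Limits

lemma GoodT.inter {n : ℕ} {d : Dat n} {T : Fin n → Prop} (hT : GoodT d T) (U : Fin n → Prop)
    (hU : ∀ i j l, U i → U l → l ≤ j → j ≤ i → U j) : GoodT d (fun j => T j ∧ U j) :=
  ⟨fun i j h h' => hT.1 i j h.1 h'.1,
    fun i j l h h' h1 h2 => ⟨hT.2 i j l h.1 h'.1 h1 h2, hU i j l h.2 h'.2 h1 h2⟩⟩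

namespace EObj
variable {k : Type} [Field k] {n : ℕ} {d : Dat n}

/-- exactness on `T` -/
def exT {A B C : EObj k d} (f : A ⟶ B) (g : B ⟶ C) (T : Fin n → Prop) : Prop :=
  ∀ x ∈ B.supp T, dT g T x = 0 → ∃ y ∈ A.supp T, dT f T y = x

/-- exactness on the diagonal -/
def exd {A B C : EObj k d} (f : A ⟶ B) (g : B ⟶ C) (i : Fin n) : Prop :=
  ∀ x : B.X i, g.f i i x = 0 → ∃ y : A.X i, f.f i i y = x

lemma not_NE_of_lt {i j : Fin n} (h : i < j) : ¬ d.NE j i := fun h' => absurd h (not_lt.2 (d.le h'))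

lemma exT_of_diag {A B C : EObj k d} (f : A ⟶ B) (g : B ⟶ C) (hfg : f ≫ g = 0)
    {T : Fin n → Prop} (hT : GoodT d T) (hd : ∀ i, T i → exd f g i) : exT f g T := by
  have key : ∀ m : ℕ, ∀ x ∈ B.supp T, dT g T x = 0 → (∀ i : Fin n, m ≤ i.1 → x i = 0) →
      ∃ y ∈ A.supp T, dT f T y = x := by
    intro m
    induction m with
    | zero =>
      intro x hx _ h0
      refine ⟨0, zero_mem _, ?_⟩
      rw [map_zero]
      funext i
      exact (h0 i (Nat.zero_le _)).symm
    | succ m ih =>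
      intro x hx hg h0
      by_cases hm : ∃ i : Fin n, i.1 = m ∧ T i
      · obtain ⟨i, him, hi⟩ := hm
        have h1 : g.f i i (x i) = 0 := by
          have h2 := congrFun hg i
          rw [dT_apply _ _ hi, Finset.sum_eq_single i] at h2
          · exact h2
          · intro j _ hj
            by_cases hij : d.NE i j
            · have : i < j := lt_of_le_of_ne (d.le hij) hj.symm
              rw [h0 j (by have : i.1 < j.1 := this; omega), map_zero]
            · exact g.supp' hij _
          · simp
        obtain ⟨y, hy⟩ := hd i hi _ h1
        have hy0 : (Pi.single i y : ∀ i, A.X i) ∈ A.supp T := single_mem hi y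
        obtain ⟨y', hy', h2⟩ := ih (x - dT f T (Pi.single i y))
          (Submodule.sub_mem _ hx (dT_mem _ _ _))
          (by rw [map_sub, hg, ← dT_comp f g hT hy0, hfg, dT_zero, sub_zero])
          (by
            intro j hj
            by_cases hTj : T j
            · rw [Pi.sub_apply, dT_single _ _ _ hTj]
              by_cases hij : j = i
              · subst hij; rw [hy, sub_self]
              · have : i.1 ≠ j.1 := fun h => hij (Fin.ext h.symm)
                have hlt : i < j := by
                  show i.1 < j.1
                  omega
                rw [h0 j (by omega), f.supp' (not_NE_of_lt hlt), sub_zero]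
            · rw [Pi.sub_apply, hx j hTj, dT_apply_ne _ _ hTj, sub_zero])
        refine ⟨y' + Pi.single i y, Submodule.add_mem _ hy' hy0, ?_⟩
        rw [map_add, h2, sub_add_cancel]
      · refine ih x hx hg fun i hi => ?_
        by_cases hT' : T i
        · refine h0 i ?_
          have : i.1 ≠ m := fun h => hm ⟨i, h, hT'⟩
          omega
        · exact hx i hT'
  intro x hx hg
  exact key n x hx hg (fun i hi => absurd i.2 (by omega))

open Classical in
lemma diag_of_exT {A B C D D' : EObj k d} (e : A ⟶ B) (f : B ⟶ C) (g : C ⟶ D) (h : D ⟶ D')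
    (hef : e ≫ f = 0) (hgh : g ≫ h = 0)
    {T : Fin n → Prop} (hT : GoodT d T) {i : Fin n} (hi : T i)
    (h1 : ∀ j, T j → j ≠ i → exd e f j) (h2 : ∀ j, T j → j ≠ i → exd g h j) (hex : exT f g T) :
    exd f g i := by
  intro z hz
  have hlo : GoodT d (fun j => T j ∧ j < i) := hT.inter _ fun a b c ha _ _ h' => lt_of_le_of_lt h' ha
  have hhi : GoodT d (fun j => T j ∧ i < j) := hT.inter _ fun a b c _ hc h' _ => lt_of_lt_of_le hc h'
  have elo := exT_of_diag g h hgh hlo (fun j hj => h2 j hj.1 hj.2.ne)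
  have ehi := exT_of_diag e f hef hhi (fun j hj => h1 j hj.1 hj.2.ne')
  have hz0 : (Pi.single i z : ∀ i, C.X i) ∈ C.supp T := single_mem hi z
  set w := dT g T (Pi.single i z) with hw
  have hw0 : ∀ j, ¬ (T j ∧ j < i) → w j = 0 := by
    intro j hj
    by_cases hTj : T j
    · rw [hw, dT_single _ _ _ hTj]
      by_cases hji : j = i
      · subst hji; exact hz
      · refine g.supp' (not_NE_of_lt (lt_of_le_of_ne (not_lt.1 fun h => hj ⟨hTj, h⟩) (Ne.symm hji))) _
    · exact dT_apply_ne _ _ hTj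
  have hhw : dT h T w = 0 := by rw [hw, ← dT_comp g h hT hz0, hgh, dT_zero]
  obtain ⟨u, hu, hgu⟩ := elo w hw0 (by
    funext j
    by_cases hj : T j ∧ j < i
    · rw [dT_apply (T := fun j => T j ∧ j < i) _ _ hj, ← dT_apply (T := T) _ _ hj.1, hhw]
    · rw [dT_apply_ne (T := fun j => T j ∧ j < i) _ _ hj]; rfl)
  have huT : u ∈ C.supp T := fun j hj => hu j fun h => hj h.1
  have hguT : dT g T u = w := by
    funext j
    by_cases hj : T j ∧ j < i
    · rw [dT_apply _ _ hj.1, ← dT_apply (T := fun j => T j ∧ j < i) _ _ hj, hgu]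
    · rw [hw0 j hj]
      by_cases hTj : T j
      · have hij : i ≤ j := not_lt.1 fun h => hj ⟨hTj, h⟩
        rw [dT_apply _ _ hTj]
        refine Finset.sum_eq_zero fun l _ => ?_
        obtain hl | hl := supp_or hu l
        · exact g.supp' (not_NE_of_lt (lt_of_lt_of_le hl.2 hij)) _
        · rw [hl, map_zero]
      · exact dT_apply_ne _ _ hTj
  obtain ⟨y, hy, hfy⟩ := hex (Pi.single i z - u) (Submodule.sub_mem _ hz0 huT)
    (by rw [map_sub, hguT, sub_self])
  set v : ∀ j, B.X j := fun j => if i < j then y j else 0 with hv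
  have hv0 : v ∈ B.supp (fun j => T j ∧ i < j) := by
    intro j hj
    by_cases hij : i < j
    · rw [hv]; simp only [hij, if_true]
      exact hy j fun h => hj ⟨h, hij⟩
    · rw [hv]; simp only [hij, if_false]
  obtain ⟨t, ht, het⟩ := ehi v hv0 (by
    funext j
    by_cases hj : T j ∧ i < j
    · rw [dT_apply (T := fun j => T j ∧ i < j) _ _ hj]
      have h3 : ∀ l, f.f l j (v l) = f.f l j (y l) := by
        intro l
        by_cases hl : d.NE j l
        · have : i < l := lt_of_lt_of_le hj.2 (d.le hl)
          rw [hv]; simp only [this, if_true]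
        · rw [f.supp' hl, f.supp' hl]
      simp only [h3]
      rw [← dT_apply (T := T) _ _ hj.1, hfy, Pi.sub_apply, Pi.single_eq_of_ne hj.2.ne',
        hu j (fun h => absurd h.2 (not_lt.2 hj.2.le)), sub_zero]; rfl
    · rw [dT_apply_ne (T := fun j => T j ∧ i < j) _ _ hj]; rfl)
  have htT : t ∈ A.supp T := fun j hj => ht j fun h => hj h.1
  have hfy' : dT f T (y - dT e T t) = Pi.single i z - u := by
    rw [map_sub, hfy, ← dT_comp e f hT htT, hef, dT_zero, sub_zero]
  refine ⟨(y - dT e T t) i, ?_⟩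
  have h4 := congrFun hfy' i
  rw [Pi.sub_apply, Pi.single_eq_same, hu i (fun h => absurd h.2 (lt_irrefl i)), sub_zero,
    dT_apply _ _ hi, Finset.sum_eq_single i] at h4
  · exact h4
  · intro l _ hl
    by_cases hil : d.NE i l
    · have hlt : i < l := lt_of_le_of_ne (d.le hil) hl.symm
      have : (y - dT e T t) l = 0 := by
        by_cases hTl : T l
        · have h5 := congrFun het l
          rw [dT_apply (T := fun j => T j ∧ i < j) _ _ ⟨hTl, hlt⟩, ← dT_apply (T := T) _ _ hTl] at h5
          rw [Pi.sub_apply, h5, hv]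
          simp only [hlt, if_true, sub_self]
        · rw [Pi.sub_apply, hy l hTl, dT_apply_ne _ _ hTl, sub_zero]
      rw [this, map_zero]
    · exact f.supp' hil _
  · simp

variable {Q : Set (ℕ × ℕ)} {hQ : Good n Q}

lemma acyclic_iff (s : Fam d (ZQ n Q)) (Y : CochainComplex (EObj k d) ℤ) :
    (((Fun s ⋙ L hQ).mapHomologicalComplex _).obj Y).Acyclic ↔
      ∀ a b c, a + 1 = b → b + 1 = c → ∀ i, exd (Y.d a b) (Y.d b c) i := by
  rw [acyclic_rep]
  have h0 : (∀ a b c : ℤ, a + 1 = b → b + 1 = c → ∀ w x,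
      ((Fun s).map (Y.d b c)).f w x = 0 → ∃ y, ((Fun s).map (Y.d a b)).f w y = x) ↔
      ∀ a b c : ℤ, a + 1 = b → b + 1 = c → ∀ w, exT (Y.d a b) (Y.d b c) (s.S w) := by
    constructor
    · intro h a b c hab hbc w x hx hg
      obtain ⟨y, hy⟩ := h a b c hab hbc w ⟨x, hx⟩ (Subtype.ext hg)
      exact ⟨y.1, y.2, congrArg Subtype.val hy⟩
    · intro h a b c hab hbc w x hg
      obtain ⟨y, hy, hfy⟩ := h a b c hab hbc w x.1 x.2 (congrArg Subtype.val hg)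
      exact ⟨⟨y, hy⟩, Subtype.ext hfy⟩
  rw [h0]
  constructor
  · intro h
    have key : ∀ m i, s.ρ i = m → ∀ a b c, a + 1 = b → b + 1 = c → exd (Y.d a b) (Y.d b c) i := by
      intro m
      induction m using Nat.strong_induction_on with
      | _ m ih =>
        intro i hi a b c hab hbc
        refine diag_of_exT (Y.d (a - 1) a) (Y.d a b) (Y.d b c) (Y.d c (c + 1)) (Y.d_comp_d _ _ _)
          (Y.d_comp_d _ _ _) (s.good i) (s.s0 i) ?_ ?_ (h a b c hab hbc i)
        · intro j hj hji
          exact ih _ (hi ▸ s.s6 hj hji) j rfl _ _ _ (by omega) hab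
        · intro j hj hji
          exact ih _ (hi ▸ s.s6 hj hji) j rfl _ _ _ hbc rfl
    intro a b c hab hbc i
    exact key _ i rfl a b c hab hbc
  · intro h a b c hab hbc w
    exact exT_of_diag _ _ (Y.d_comp_d _ _ _) (s.good w) (fun i _ => h a b c hab hbc i)

end EObj
end NakDer
end

section
namespace NakDer
open CategoryTheory Category Limits

/-- The basic data attached to a cut vertex `p` and relations `Z`. -/
def mkDat {n : ℕ} (p : Fin n) (Z : Fin n → Fin n → Prop) (hlt : ∀ a b, Z a b → a < b) : Dat n where
  p := p
  Z a b := Z a b ∧ p ≤ a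
  NE a b := (a ≤ b ∧ b ≤ p ∧ ∀ c e, Z c e → a ≤ c → e ≤ b → False) ∨ (p < b ∧ a = b)
  le := by
    rintro a b (h | h)
    · exact h.1
    · exact h.2.le
  sub := by
    rintro a b c e (⟨h1, h2, h3⟩ | ⟨h1, rfl⟩) hac hce heb
    · exact .inl ⟨hce, heb.trans h2, fun c' e' hz h h' => h3 c' e' hz (hac.trans h) (h'.trans heb)⟩
    · have : c = a := le_antisymm (hce.trans heb) hac
      have : e = a := le_antisymm heb (hac.trans hce)
      subst_vars
      exact .inr ⟨h1, rfl⟩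
  refl a := by
    obtain h | h := le_or_gt a p
    · exact .inl ⟨le_rfl, h, fun c e hz h h' =>
        absurd (hlt c e hz) (not_lt.2 (h'.trans h))⟩
    · exact .inr ⟨h, rfl⟩
  tail := by
    rintro a b (h | h) hp
    · exact absurd h.2.1 (not_le.2 hp)
    · exact h.2

variable {n : ℕ} {p : Fin n} {Z : Fin n → Fin n → Prop} {hlt : ∀ a b, Z a b → a < b}

lemma mkDat_no {a b c e} (h : (mkDat p Z hlt).NE a b) (hz : Z c e) (h1 : a ≤ c) (h2 : e ≤ b) :
    False := by
  rcases h with h | h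
  · exact h.2.2 c e hz h1 h2
  · have := hlt c e hz
    have h3 := h.2
    subst h3
    exact absurd this (not_lt.2 (h2.trans h1))

/-- The first family. -/
def fam1 (p : Fin n) (Z : Fin n → Fin n → Prop) (hlt : ∀ a b, Z a b → a < b)
    (hsep : ∀ a b, Z a b → b ≤ p ∨ p ≤ a) {Zt : Fin n → Fin n → Prop}
    (hZt : ∀ a b, Zt a b → Z a b ∨ (a < p ∧ p < b)) : Fam (mkDat p Z hlt) Zt where
  S w i := (mkDat p Z hlt).NE i w
  s0 := (mkDat p Z hlt).refl
  sleft h hw := ((mkDat p Z hlt).le h).trans hw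
  stail h hw := (mkDat p Z hlt).tail h hw
  sconv h h' h1 h2 := (mkDat p Z hlt).sub h2 le_rfl (((mkDat p Z hlt).le h1).trans h) h'
  s1 h1 h2 h := (mkDat p Z hlt).sub h2 le_rfl h ((mkDat p Z hlt).le h1)
  s2 h1 h2 h h' := (mkDat p Z hlt).sub h2 h (h'.trans ((mkDat p Z hlt).le h1)) le_rfl
  s3 h h' h1 h2 h3 := iff_of_true
    ((mkDat p Z hlt).sub h2 ((mkDat p Z hlt).le h3) (((mkDat p Z hlt).le h1).trans h) le_rfl)
    ((mkDat p Z hlt).sub h2 le_rfl (((mkDat p Z hlt).le h3).trans ((mkDat p Z hlt).le h1)) h)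
  s4 {i j} h := ⟨i, (mkDat p Z hlt).refl i, h⟩
  s5 {w i j} hw h1 h2 h := .inl ⟨i, (mkDat p Z hlt).le h1, (mkDat p Z hlt).refl i,
    fun h3 => absurd h (not_lt.2 ((mkDat p Z hlt).le h3))⟩
  ρ i := i.1
  s6 {i j} h hne := (lt_of_le_of_ne ((mkDat p Z hlt).le h) hne : j < i)
  zt {a b} hz hab := by
    obtain h | h := hZt a b hz
    · obtain h1 | h1 := hsep a b h
      · exact .inl ⟨h1, fun i hi => mkDat_no hi.2 h ((mkDat p Z hlt).le hi.1) le_rfl⟩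
      · refine .inr (.inr ⟨lt_of_le_of_lt h1 (hlt a b h), ?_⟩)
        show Z (max p a) b ∧ p ≤ max p a
        rw [max_eq_right h1]
        exact ⟨h, h1⟩
    · exact .inr (.inl ⟨h.2, h.1.le, fun h' => absurd h.1 (not_lt.2 ((mkDat p Z hlt).le h'))⟩)

/-- The second family. -/
def fam2 (p : Fin n) (Z : Fin n → Fin n → Prop) (hlt : ∀ a b, Z a b → a < b)
    (hsep : ∀ a b, Z a b → b ≤ p ∨ p ≤ a) : Fam (mkDat p Z hlt) Z where
  S w i := (mkDat p Z hlt).NE w i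
  s0 := (mkDat p Z hlt).refl
  sleft {w i} h hw := by
    by_contra h'
    have h1 := not_le.1 h'
    have h2 := (mkDat p Z hlt).tail h h1
    subst h2
    exact h' hw
  stail h hw := ((mkDat p Z hlt).tail h (lt_of_lt_of_le hw ((mkDat p Z hlt).le h))).symm
  sconv h h' h1 h2 := (mkDat p Z hlt).sub h1 h (h'.trans ((mkDat p Z hlt).le h2)) le_rfl
  s1 h1 h2 h := (mkDat p Z hlt).sub h1 ((mkDat p Z hlt).le h2) h le_rfl
  s2 h1 h2 h h' := (mkDat p Z hlt).sub h1 le_rfl (((mkDat p Z hlt).le h2).trans h) h'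
  s3 h h' h1 h2 h3 := iff_of_true
    ((mkDat p Z hlt).sub h1 h (((mkDat p Z hlt).le h2).trans ((mkDat p Z hlt).le h3)) le_rfl)
    ((mkDat p Z hlt).sub h1 le_rfl (h.trans ((mkDat p Z hlt).le h2)) ((mkDat p Z hlt).le h3))
  s4 {i j} h := ⟨j, h, (mkDat p Z hlt).refl j⟩
  s5 {w i j} hw h1 h2 h := .inr ⟨j, (mkDat p Z hlt).le h2, by
      by_contra h'
      have h3 := not_le.1 h'
      have h4 := (mkDat p Z hlt).tail h2 h3
      subst h4
      exact h' hw, (mkDat p Z hlt).refl j,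
    fun h3 => absurd h (not_lt.2 ((mkDat p Z hlt).le h3))⟩
  ρ i := n - i.1
  s6 {i j} h hne := by
    have h1 : i.1 < j.1 := (lt_of_le_of_ne ((mkDat p Z hlt).le h) hne.symm : i < j)
    have := j.2
    show n - j.1 < n - i.1
    omega
  zt {a b} hz hab := by
    obtain h1 | h1 := hsep a b hz
    · exact .inl ⟨h1, fun i hi => mkDat_no hi.1 hz le_rfl ((mkDat p Z hlt).le hi.2)⟩
    · refine .inr (.inr ⟨lt_of_le_of_lt h1 (hlt a b hz), ?_⟩)
      show Z (max p a) b ∧ p ≤ max p a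
      rw [max_eq_right h1]
      exact ⟨hz, h1⟩

namespace EObj
variable {k : Type} [Field k] {d : Dat n} {Zt : Fin n → Fin n → Prop}

lemma dT_diag (hZ : ∀ a b, d.Z a b → Zt a b) {M N : Rep k n Zt} (g : M ⟶ N) (T : Fin n → Prop)
    {x} (hx : x ∈ (diagObj (d := d) hZ M).supp T) (j) :
    dT (diagMap (d := d) hZ g) T x j = g.f j (x j) := by
  by_cases h : T j
  · rw [dT_apply _ _ h, Finset.sum_eq_single j]
    · exact diagMap_self hZ g j _
    · intro l _ hl
      exact diagMap_ne hZ g hl _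
    · simp
  · rw [dT_apply_ne _ _ h]
    refine Eq.trans ?_ (congrArg (g.f j) (hx j h)).symm
    exact (map_zero (g.f j)).symm

end EObj

lemma map_eq_zero {k : Type} [Field k] {Zt : Fin n → Fin n → Prop} (hZ : ∀ a b, Z a b → Zt a b)
    (hlt : ∀ a b, Z a b → a < b)
    (M : Rep k n Zt) {w i : Fin n} (h : w ≤ i) (hp : i ≤ p) (hne : ¬ (mkDat p Z hlt).NE w i) (x) :
    M.map w i h x = 0 := by
  have : ∃ c e, Z c e ∧ w ≤ c ∧ e ≤ i := by
    by_contra hcon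
    refine hne (.inl ⟨h, hp, fun c e hz h1 h2 => hcon ⟨c, e, hz, h1, h2⟩⟩)
  obtain ⟨c, e, hz, h1, h2⟩ := this
  rw [← M.map_comp w c i h1 ((hlt c e hz).le.trans h2), ← M.map_comp c e i (hlt c e hz).le h2,
    M.rel c e _ (hZ c e hz), map_zero]

end NakDer
end

section
namespace NakDer
open CategoryTheory Category Limits
open EObj

section fact1
variable {k : Type} [Field k] {n : ℕ} (p : Fin n) (Z : Fin n → Fin n → Prop)
  (hlt : ∀ a b, Z a b → a < b)
  (hsep : ∀ a b, Z a b → b ≤ p ∨ p ≤ a) {Zt : Fin n → Fin n → Prop}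
  (hZt : ∀ a b, Zt a b → Z a b ∨ (a < p ∧ p < b))
  (hZ : ∀ a b, Z a b → Zt a b)

/-- summand of the counit -/
def e1f {Zt : Fin n → Fin n → Prop} (M : Rep k n Zt) (i w : Fin n) : M.X i →ₗ[k] M.X w :=
  if h : i ≤ w then M.map i w h else 0

lemma e1f_le {Zt : Fin n → Fin n → Prop} (M : Rep k n Zt) {i w : Fin n} (h : i ≤ w) :
    e1f M i w = M.map i w h := dif_pos h

lemma e1f_nat {Zt : Fin n → Fin n → Prop} {M N : Rep k n Zt} (g : M ⟶ N) (i w : Fin n) (x) :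
    e1f N i w (g.f i x) = g.f w (e1f M i w x) := by
  by_cases h : i ≤ w
  · rw [e1f_le _ h, e1f_le _ h, g.comm]
  · simp [e1f, h]

/-- the counit on components -/
noncomputable def e1 {Zt : Fin n → Fin n → Prop} (M : Rep k n Zt) (w : Fin n) :
    (∀ i, M.X i) →ₗ[k] M.X w := ∑ i, (e1f M i w).comp (LinearMap.proj i)

lemma e1_apply {Zt : Fin n → Fin n → Prop} (M : Rep k n Zt) (w : Fin n) (x) :
    e1 M w x = ∑ i, e1f M i w (x i) := by simp [e1]

lemma e1_eq {Zt : Fin n → Fin n → Prop} (M : Rep k n Zt) (w : Fin n) (x : ∀ i, M.X i)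
    (h : ∀ j, j ≠ w → x j = 0) : e1 M w x = x w := by
  rw [e1_apply, Finset.sum_eq_single w]
  · rw [e1f_le _ le_rfl, M.map_id]
  · intro j _ hj; rw [h j hj, map_zero]
  · simp

/-- shorthand -/
noncomputable abbrev F1 : EObj k (mkDat p Z hlt) ⥤ Rep k n Zt := Fun (fam1 p Z hlt hsep hZt)

/-- shorthand -/
noncomputable abbrev D1 : Rep k n Zt ⥤ EObj k (mkDat p Z hlt) :=
  diag (d := mkDat p Z hlt) (fun a b h => hZ a b h.1)

lemma e1_nat {Zt : Fin n → Fin n → Prop} {M N : Rep k n Zt} (g : M ⟶ N) (w : Fin n)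
    (x : ∀ i, M.X i) (y : ∀ i, N.X i) (h : ∀ i, y i = g.f i (x i)) :
    e1 N w y = g.f w (e1 M w x) := by
  rw [e1_apply, e1_apply, map_sum]
  refine Finset.sum_congr rfl fun i _ => ?_
  rw [h, e1f_nat]

include hZ in
lemma e1_comm (hZp : ∀ a b, a < p → p < b → ∀ (M : Rep k n Zt) h x, M.map a b h x = 0)
    (M : Rep k n Zt) (w w' : Fin n) (h : w ≤ w')
    (x x' : ∀ i, M.X i) (hxs : ∀ i, ¬ (mkDat p Z hlt).NE i w → x i = 0)
    (hle : w' ≤ p → ∀ i, ((mkDat p Z hlt).NE i w' → x' i = x i) ∧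
      (¬ (mkDat p Z hlt).NE i w' → x' i = 0))
    (hgt : p < w' → ∀ m, m = max p w → ∀ hmw, x' = Pi.single w' (M.map m w' hmw (x m))) :
    e1 M w' x' = M.map w w' h (e1 M w x) := by
  have hr : M.map w w' h (e1 M w x) = ∑ i, e1f M i w' (x i) := by
    rw [e1_apply, map_sum]
    refine Finset.sum_congr rfl fun i _ => ?_
    by_cases hi : i ≤ w
    · rw [e1f_le _ hi, e1f_le _ (hi.trans h), M.map_comp]
    · rw [hxs i (fun h' => hi ((mkDat p Z hlt).le h')), map_zero, map_zero, map_zero]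
  rw [hr]
  obtain hp | hp := le_or_gt w' p
  · rw [e1_apply]
    refine Finset.sum_congr rfl fun i _ => ?_
    by_cases hi : (mkDat p Z hlt).NE i w'
    · rw [(hle hp i).1 hi]
    · rw [(hle hp i).2 hi, map_zero]
      by_cases hi' : i ≤ w'
      · rw [e1f_le _ hi', map_eq_zero hZ hlt M hi' hp hi]
      · simp [e1f, hi']
  · obtain ⟨m, hm⟩ : ∃ m, m = max p w := ⟨_, rfl⟩
    have hmw : m ≤ w' := hm ▸ max_le hp.le h
    rw [hgt hp m hm hmw, e1_eq M w' _ fun j hj => Pi.single_eq_of_ne hj _, Pi.single_eq_same,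
      Finset.sum_eq_single m]
    · rw [e1f_le _ hmw]
    · intro i _ hi
      by_cases hiw : (mkDat p Z hlt).NE i w
      · have h1 := (mkDat p Z hlt).le hiw
        obtain hw | hw := le_or_gt w p
        · rw [max_eq_left hw] at hm
          rw [e1f_le _ (h1.trans h), hZp i w' (lt_of_le_of_ne (h1.trans hw) (hm ▸ hi)) hp]
        · rw [max_eq_right hw.le] at hm
          exact absurd (((mkDat p Z hlt).tail hiw hw).trans hm.symm) hi
      · rw [hxs i hiw, map_zero]
    · simp

/-- The counit. -/
noncomputable def ee1 (hZp : ∀ a b, a < p → p < b → ∀ (M : Rep k n Zt) h x, M.map a b h x = 0) :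
    D1 p Z hlt hZ ⋙ F1 p Z hlt hsep hZt ⟶ 𝟭 (Rep k n Zt) where
  app M :=
    { f := fun w => (e1 M w).comp
        (((D1 p Z hlt hZ).obj M).supp ((fam1 p Z hlt hsep hZt).S w)).subtype
      comm := fun w w' h x => e1_comm p Z hlt hZ hZp M w w' h x.1 _ x.2
        (fun hp i => ⟨fun hi => (map_val_le (fam1 p Z hlt hsep hZt) ((D1 p Z hlt hZ).obj M) h hp
            x i).trans (if_pos hi),
          fun hi => (map_val_le (fam1 p Z hlt hsep hZt) ((D1 p Z hlt hZ).obj M) h hp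
            x i).trans (if_neg hi)⟩)
        (fun hp m hm hmw => map_val_gt (fam1 p Z hlt hsep hZt) ((D1 p Z hlt hZ).obj M) h hp x
          m hm hmw) }
  naturality M N g := Rep.hom_ext fun w x =>
    e1_nat g w x.1 _ (fun i => dT_diag _ g _ x.2 i)

end fact1

section fact1'
variable {k : Type} [Field k] {n : ℕ} (p : Fin n) {Q Q' : Set (ℕ × ℕ)} (hQ : Good n Q)
  (hlt : ∀ a b, ZQ n Q' a b → a < b)
  (hsep : ∀ a b, ZQ n Q' a b → b ≤ p ∨ p ≤ a)
  (hZt : ∀ a b, ZQ n Q a b → ZQ n Q' a b ∨ (a < p ∧ p < b))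
  (hZ : ∀ a b, ZQ n Q' a b → ZQ n Q a b)

include hZ in
lemma fact1 (hZp : ∀ a b, a < p → p < b → ∀ (M : Rep k n (ZQ n Q)) h x, M.map a b h x = 0)
    (X : CochainComplex (ModuleCat.{0} (AQ k n Q)ᵐᵒᵖ) ℤ) :
    HL (F1 (k := k) p (ZQ n Q') hlt hsep hZt ⋙ L hQ) X := by
  refine HL_rep _ (D1 p (ZQ n Q') hlt hZ) (ee1 p (ZQ n Q') hlt hsep hZt hZ hZp) ?_
    (fun c M => ∀ i : Fin n, (i ≤ p ∧ i.1 < c) ∨ (p < i ∧ 1 ≤ c) → Subsingleton (M.X i)) (p.1 + 1)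
    ?_ ?_ ?_ X
  · intro M w z
    refine ⟨⟨Pi.single (M := M.X) w z, ?_⟩, ?_⟩
    · exact single_mem (M := (D1 p (ZQ n Q') hlt hZ).obj M)
        (T := (fam1 p (ZQ n Q') hlt hsep hZt).S w) ((mkDat p _ hlt).refl w) z
    · refine (e1_eq M w _ fun j hj => Pi.single_eq_of_ne hj _).trans ?_
      exact Pi.single_eq_same _ _
  · intro M i h
    exfalso
    omega
  · intro M h i
    refine h i ?_
    obtain h1 | h1 := le_or_gt i p
    · exact .inl ⟨h1, Nat.lt_succ_of_le h1⟩
    · exact .inr ⟨h1, by omega⟩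
  · intro c N M ι hinj h0 hP v hv
    refine ⟨fun z z' => ?_⟩
    have key : ∀ z, ι.f v z = 0 := by
      intro z
      have hxs : ∀ i, ¬ (mkDat p (ZQ n Q') hlt).NE i v → (ι.f v z).1 i = 0 := (ι.f v z).2
      have h1 : e1 M v (ι.f v z).1 = 0 := congrArg (fun u : N ⟶ M => u.f v z) h0
      have h2 : ∀ j, j ≠ v → (ι.f v z).1 j = 0 := by
        intro j hj
        by_cases hjv : (mkDat p (ZQ n Q') hlt).NE j v
        · obtain hv | hv := hv
          · have hjv' : j < v := lt_of_le_of_ne ((mkDat p _ hlt).le hjv) hj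
            have : Subsingleton (M.X j) := hP j (.inl ⟨(hjv'.le).trans hv.1, by
              have : j.1 < v.1 := hjv'
              omega⟩)
            exact Subsingleton.elim (α := M.X j) _ _
          · exact absurd ((mkDat p _ hlt).tail hjv hv.1) hj
        · exact hxs j hjv
      have h3 := (e1_eq M v _ h2).symm.trans h1
      refine val_ext _ fun j => ?_
      by_cases hj : j = v
      · subst hj; exact h3
      · exact h2 j hj
    exact hinj v ((key z).trans (key z').symm)

end fact1'
end NakDer
end

section
namespace NakDer
open CategoryTheory Category Limits
open EObj

section fact2
variable {k : Type} [Field k] {n : ℕ} (p : Fin n) (Z : Fin n → Fin n → Prop)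
  (hlt : ∀ a b, Z a b → a < b)
  (hsep : ∀ a b, Z a b → b ≤ p ∨ p ≤ a)

open Classical in
/-- the unit on components -/
noncomputable def u2 (M : Rep k n Z) (w : Fin n) : M.X w →ₗ[k] (∀ i, M.X i) :=
  LinearMap.pi fun i => if h : w ≤ i ∧ (mkDat p Z hlt).NE w i then M.map w i h.1 else 0

lemma u2_apply (M : Rep k n Z) {w i : Fin n} (h : w ≤ i) (h' : (mkDat p Z hlt).NE w i) (x) :
    u2 p Z hlt M w x i = M.map w i h x := by
  have : w ≤ i ∧ (mkDat p Z hlt).NE w i := ⟨h, h'⟩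
  simp [u2, this]

lemma u2_ne (M : Rep k n Z) {w i : Fin n} (h' : ¬ (mkDat p Z hlt).NE w i) (x) :
    u2 p Z hlt M w x i = 0 := by
  simp [u2, h']

lemma u2_apply' (M : Rep k n Z) {w i : Fin n} (h : w ≤ i) (hi : i ≤ p) (x) :
    u2 p Z hlt M w x i = M.map w i h x := by
  by_cases h' : (mkDat p Z hlt).NE w i
  · exact u2_apply p Z hlt M h h' x
  · rw [u2_ne p Z hlt M h', map_eq_zero (fun _ _ h => h) hlt M h hi h']

lemma u2_nat {M N : Rep k n Z} (g : M ⟶ N) (w i : Fin n) (x) :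
    u2 p Z hlt N w (g.f w x) i = g.f i (u2 p Z hlt M w x i) := by
  by_cases h : (mkDat p Z hlt).NE w i
  · have h' := (mkDat p Z hlt).le h
    rw [u2_apply p Z hlt N h' h, u2_apply p Z hlt M h' h, g.comm]
  · rw [u2_ne p Z hlt N h, u2_ne p Z hlt M h, map_zero]

/-- shorthand -/
noncomputable abbrev F2 : EObj k (mkDat p Z hlt) ⥤ Rep k n Z := Fun (fam2 p Z hlt hsep)

/-- shorthand -/
noncomputable abbrev D2 : Rep k n Z ⥤ EObj k (mkDat p Z hlt) :=
  diag (d := mkDat p Z hlt) (fun _ _ h => h.1)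

include hsep in
lemma u2_comm (M : Rep k n Z) (w w' : Fin n) (h : w ≤ w') (x : M.X w)
    (x' : ∀ i, M.X i)
    (hle : w' ≤ p → ∀ i, ((mkDat p Z hlt).NE w' i → x' i = u2 p Z hlt M w x i) ∧
      (¬ (mkDat p Z hlt).NE w' i → x' i = 0))
    (hgt : p < w' → ∀ m, m = max p w → ∀ hmw,
      x' = Pi.single w' (M.map m w' hmw (u2 p Z hlt M w x m))) (i : Fin n) :
    u2 p Z hlt M w' (M.map w w' h x) i = x' i := by
  obtain hp | hp := le_or_gt w' p
  · by_cases hi : (mkDat p Z hlt).NE w' i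
    · have hi' := (mkDat p Z hlt).le hi
      have hip : i ≤ p := (fam2 p Z hlt hsep).sleft hi hp
      rw [(hle hp i).1 hi, u2_apply p Z hlt M hi' hi, u2_apply' p Z hlt M (h.trans hi') hip,
        M.map_comp]
    · rw [(hle hp i).2 hi, u2_ne p Z hlt M hi]
  · obtain ⟨m, hm⟩ : ∃ m, m = max p w := ⟨_, rfl⟩
    have hmw : m ≤ w' := hm ▸ max_le hp.le h
    have hwm : w ≤ m := hm ▸ le_max_right _ _
    rw [hgt hp m hm hmw]
    by_cases hi : i = w'
    · subst hi
      rw [Pi.single_eq_same, u2_apply p Z hlt M le_rfl ((mkDat p Z hlt).refl _), M.map_comp]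
      have : u2 p Z hlt M w x m = M.map w m hwm x := by
        obtain hw | hw := le_or_gt w p
        · rw [max_eq_left hw] at hm
          exact u2_apply' p Z hlt M hwm hm.le x
        · rw [max_eq_right hw.le] at hm
          subst hm
          exact u2_apply p Z hlt M hwm ((mkDat p Z hlt).refl _) x
      rw [this, M.map_comp]
    · rw [Pi.single_eq_of_ne hi, u2_ne]
      intro h'
      exact hi ((fam2 p Z hlt hsep).stail h' hp)

/-- The unit. -/
noncomputable def uu2 : 𝟭 (Rep k n Z) ⟶ D2 p Z hlt ⋙ F2 p Z hlt hsep where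
  app M :=
    { f := fun w => (u2 p Z hlt M w).codRestrict
        (((D2 p Z hlt).obj M).supp ((fam2 p Z hlt hsep).S w)) (fun x i hi => u2_ne p Z hlt M hi x)
      comm := fun w w' h x => val_ext (fam2 p Z hlt hsep) (M := (D2 p Z hlt).obj M) fun i =>
        u2_comm p Z hlt hsep M w w' h x _
        (fun hp i => ⟨fun hi => (map_val_le (fam2 p Z hlt hsep) ((D2 p Z hlt).obj M) h hp
            _ i).trans (if_pos (c := (fam2 p Z hlt hsep).S w' i) hi),
          fun hi => (map_val_le (fam2 p Z hlt hsep) ((D2 p Z hlt).obj M) h hp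
            _ i).trans (if_neg (c := (fam2 p Z hlt hsep).S w' i) hi)⟩)
        (fun hp m hm hmw => map_val_gt (fam2 p Z hlt hsep) ((D2 p Z hlt).obj M) h hp _
          m hm hmw) i }
  naturality M N g := Rep.hom_ext fun w x => val_ext (fam2 p Z hlt hsep)
    (M := (D2 p Z hlt).obj N) fun i =>
    (u2_nat p Z hlt g w i x).trans (dT_diag (d := mkDat p Z hlt) (fun _ _ h => h.1) g
      ((fam2 p Z hlt hsep).S w)
      (x := u2 p Z hlt M w x) (fun i hi => u2_ne p Z hlt M hi x) i).symm

end fact2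

section fact2'
variable {k : Type} [Field k] {n : ℕ} (p : Fin n) {Q : Set (ℕ × ℕ)} (hQ : Good n Q)
  (hlt : ∀ a b, ZQ n Q a b → a < b)
  (hsep : ∀ a b, ZQ n Q a b → b ≤ p ∨ p ≤ a)

lemma fact2 (X : CochainComplex (ModuleCat.{0} (AQ k n Q)ᵐᵒᵖ) ℤ) :
    HR (F2 (k := k) p (ZQ n Q) hlt hsep ⋙ L hQ) X := by
  refine HR_rep _ (D2 p (ZQ n Q) hlt) (uu2 p (ZQ n Q) hlt hsep) ?_
    (fun c M => ∀ i : Fin n, (i ≤ p ∧ p.1 < i.1 + c) ∨ (p < i ∧ 1 ≤ c) → Subsingleton (M.X i))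
    (p.1 + 1) ?_ ?_ ?_ X
  · intro M w z z' hz
    have h1 : ∀ z : M.X w, u2 p _ hlt M w z w = z := fun z =>
      (u2_apply p _ hlt M le_rfl ((mkDat p _ hlt).refl w) z).trans (M.map_id _ _ _)
    have h2 : u2 p _ hlt M w z w = u2 p _ hlt M w z' w := congrArg (fun y => y.1 w) hz
    exact (h1 z).symm.trans (h2.trans (h1 z'))
  · intro M i h
    exfalso
    have : i ≤ p → i.1 ≤ p.1 := fun h => h
    omega
  · intro M h i
    refine h i ?_
    obtain h1 | h1 := le_or_gt i p
    · exact .inl ⟨h1, by omega⟩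
    · exact .inr ⟨h1, by omega⟩
  · intro c N M q hsurj h0 hP v hv
    have key : ∀ z : N.X v, z = 0 := by
      intro z
      obtain ⟨x, rfl⟩ := hsurj v z
      have hxs : ∀ i, ¬ (mkDat p (ZQ n Q) hlt).NE v i → x.1 i = 0 := x.2
      have hx : (Rep.Hom.f ((uu2 p (ZQ n Q) hlt hsep).app M) v (x.1 v : M.X v)) = x := by
        refine val_ext _ fun j => ?_
        by_cases hjv : (mkDat p (ZQ n Q) hlt).NE v j
        · by_cases hj : v = j
          · subst hj
            exact (u2_apply p _ hlt M le_rfl ((mkDat p _ hlt).refl v) _).trans (M.map_id _ _ _)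
          · have hlt' : v < j := lt_of_le_of_ne ((mkDat p _ hlt).le hjv) hj
            obtain hv | hv := hv
            · have : Subsingleton (M.X j) := hP j (.inl ⟨(fam2 p _ hlt hsep).sleft hjv hv.1, by
                have : v.1 < j.1 := hlt'
                omega⟩)
              exact Subsingleton.elim (α := M.X j) _ _
            · exact absurd ((fam2 p _ hlt hsep).stail hjv hv.1).symm hj
        · exact (u2_ne p _ hlt M hjv _).trans (hxs j hjv).symm
      have h1 := congrArg (fun u : M ⟶ N => u.f v (x.1 v)) h0
      exact (congrArg (q.f v) hx).symm.trans h1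
    exact ⟨fun z z' => (key z).trans (key z').symm⟩

end fact2'
end NakDer
end

section
namespace NakDer
open CategoryTheory Category Limits
open EObj

lemma derivedEquivalent_refl (k : Type) [Field k] (A : Type) [Ring A] [Algebra k A] :
    DerivedEquivalent k A A :=
  ⟨𝟭 _, inferInstance, inferInstance, inferInstance⟩

lemma derivedEquivalent_trans {k : Type} [Field k] {A : Type} [Ring A] [Algebra k A]
    {B : Type} [Ring B] [Algebra k B] {C : Type} [Ring C] [Algebra k C]
    (h : DerivedEquivalent k A B) (h' : DerivedEquivalent k B C) : DerivedEquivalent k A C := by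
  obtain ⟨F, c, h1, h2⟩ := h
  obtain ⟨G, c', h1', h2'⟩ := h'
  exact ⟨F ⋙ G, inferInstance, inferInstance, inferInstance⟩

lemma step (k : Type) [Field k] {n : ℕ} {Q : Set (ℕ × ℕ)} (hQ : Good n Q) (v : ℕ) (hv : 1 ≤ v)
    (hvn : v + 2 ≤ n) (hs : ∀ q ∈ Q, q.1 - 1 + q.2 ≤ v ∨ v ≤ q.1 - 1) :
    DerivedEquivalent k (AQ k n (insert (v, 2) Q)) (AQ k n Q) := by
  have hQ1 : Good n (insert (v, 2) Q) := by
    rintro q (rfl | hq)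
    · exact ⟨hv, by norm_num, hvn⟩
    · exact hQ q hq
  let p : Fin n := ⟨v, by omega⟩
  have hlt : ∀ a b, ZQ n Q a b → a < b := by
    rintro a b ⟨q, hq, h1, h2⟩
    have := hQ q hq
    show a.1 < b.1
    omega
  have hsep : ∀ a b, ZQ n Q a b → b ≤ p ∨ p ≤ a := by
    rintro a b ⟨q, hq, h1, h2⟩
    show b.1 ≤ v ∨ v ≤ a.1
    have := hs q hq
    omega
  have hZt : ∀ a b, ZQ n (insert (v, 2) Q) a b → ZQ n Q a b ∨ (a < p ∧ p < b) := by
    rintro a b ⟨q, rfl | hq, h1, h2⟩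
    · right
      show a.1 < v ∧ v < b.1
      simp only at h1 h2
      omega
    · exact .inl ⟨q, hq, h1, h2⟩
  have hZ : ∀ a b, ZQ n Q a b → ZQ n (insert (v, 2) Q) a b := by
    rintro a b ⟨q, hq, h⟩
    exact ⟨q, .inr hq, h⟩
  have hZp : ∀ a b, a < p → p < b → ∀ (M : Rep k n (ZQ n (insert (v, 2) Q))) h x,
      M.map a b h x = 0 := by
    intro a b ha hb M h x
    have ha' : a.1 < v := ha
    have hb' : v < b.1 := hb
    have h1 : a ≤ (⟨v - 1, by omega⟩ : Fin n) := by show a.1 ≤ v - 1; omega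
    have h2 : (⟨v - 1, by omega⟩ : Fin n) ≤ (⟨v + 1, by omega⟩ : Fin n) := by
      show v - 1 ≤ v + 1; omega
    have h3 : (⟨v + 1, by omega⟩ : Fin n) ≤ b := by show v + 1 ≤ b.1; omega
    rw [← M.map_comp a _ b (h1.trans h2) h3, ← M.map_comp a _ _ h1 h2, M.rel _ _ h2 ?_, map_zero]
    exact ⟨(v, 2), .inl rfl, rfl, by show v + 1 = v - 1 + 2; omega⟩
  exact exists_derived_equivalence (F1 (k := k) p (ZQ n Q) hlt hsep hZt ⋙ L hQ1)
    (F2 (k := k) p (ZQ n Q) hlt hsep ⋙ L hQ) (fact1 p hQ1 hlt hsep hZt hZ hZp)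
    (fact2 p hQ hlt hsep)
    (fun Y => (EObj.acyclic_iff _ Y).trans (EObj.acyclic_iff _ Y).symm)

lemma steps (k : Type) [Field k] (n t : ℕ)
    (ns ls : Fin t → ℕ) (h : IsASNakayama n t ns ls) (s : Finset (Fin t))
    (hs : ∀ i ∈ s, ls i = 2) :
    DerivedEquivalent k (AQ k n {q | ∃ i, q = (ns i, ls i)})
      (AQ k n {q | ∃ i, i ∉ s ∧ q = (ns i, ls i)}) := by
  induction s using Finset.induction_on with
  | empty =>
    have : {q | ∃ i, i ∉ (∅ : Finset (Fin t)) ∧ q = (ns i, ls i)}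
        = {q | ∃ i, q = (ns i, ls i)} := by ext; simp
    rw [this]
    exact derivedEquivalent_refl _ _
  | insert j s hj ih =>
    refine derivedEquivalent_trans (ih fun i hi => hs i (Finset.mem_insert_of_mem hi)) ?_
    have e : {q | ∃ i, i ∉ s ∧ q = (ns i, ls i)}
        = insert (ns j, 2) {q | ∃ i, i ∉ insert j s ∧ q = (ns i, ls i)} := by
      have hj2 := hs j (Finset.mem_insert_self _ _)
      ext q
      constructor
      · rintro ⟨i, hi, rfl⟩
        by_cases hij : i = j
        · subst hij; left; rw [hj2]
        · right; exact ⟨i, by simp [hij, hi], rfl⟩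
      · rintro (rfl | ⟨i, hi, rfl⟩)
        · exact ⟨j, hj, by rw [hj2]⟩
        · exact ⟨i, fun h => hi (Finset.mem_insert_of_mem h), rfl⟩
    rw [e]
    have hj2 := hs j (Finset.mem_insert_self _ _)
    have hjn := h.end_le j
    refine step k ?_ _ (h.one_le j) (by omega) ?_
    · rintro q ⟨i, hi, rfl⟩
      exact ⟨h.one_le i, by have := h.two_le i; show 1 ≤ ls i; omega, h.end_le i⟩
    · rintro q ⟨i, hi, rfl⟩
      show ns i - 1 + ls i ≤ ns j ∨ ns j ≤ ns i - 1
      have h1 := h.one_le i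
      rcases lt_trichotomy i j with hij | hij | hij
      · have := h.almost_separate i j hij
        omega
      · exact absurd (hij ▸ Finset.mem_insert_self j s) hi
      · have := h.almost_separate j i hij
        omega

theorem main (k : Type) [Field k] (n t : ℕ)
    (ns ls : Fin t → ℕ) (h : IsASNakayama n t ns ls) :
    DerivedEquivalent k (NakayamaAlgebra k n t ns ls)
      (PathAlgebraRel k (linQuiver n)
        {p | ∃ i : Fin t, 3 ≤ ls i ∧ p = linPath n (ns i) (ls i)}) := by
  have key := steps k n t ns ls h (Finset.univ.filter fun i => ls i = 2) (by simp)
  have e1 : RQ n {q | ∃ i, q = (ns i, ls i)} = {p | ∃ i : Fin t, p = linPath n (ns i) (ls i)} := by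
    ext x
    constructor
    · rintro ⟨q, ⟨i, rfl⟩, hx⟩; exact ⟨i, hx⟩
    · rintro ⟨i, hx⟩; exact ⟨_, ⟨i, rfl⟩, hx⟩
  have e2 : RQ n {q | ∃ i, i ∉ (Finset.univ.filter fun i => ls i = 2) ∧ q = (ns i, ls i)}
      = {p | ∃ i : Fin t, 3 ≤ ls i ∧ p = linPath n (ns i) (ls i)} := by
    ext x
    constructor
    · rintro ⟨q, ⟨i, hi, rfl⟩, hx⟩
      have := h.two_le i
      simp only [Finset.mem_filter, Finset.mem_univ, true_and] at hi
      exact ⟨i, by omega, hx⟩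
    · rintro ⟨i, hi, hx⟩
      refine ⟨_, ⟨i, ?_, rfl⟩, hx⟩
      simp only [Finset.mem_filter, Finset.mem_univ, true_and]
      omega
  unfold AQ at key
  rw [e1, e2] at key
  exact key

end NakDer
end

/-- Relations of length `2` have no effect on the derived equivalence class
of a linear Nakayama algebra with almost separate relations: such an algebra is derived
equivalent to the quotient of `kA_n` by the ideal generated only by those relation paths of
length at least `3` (which is `kA_n` itself when all relations have length `2`). -/
theorem nakayama_forget_length_two (k : Type) [Field k] (n t : ℕ)
    (ns ls : Fin t → ℕ) (h : IsASNakayama n t ns ls) :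
    DerivedEquivalent k (NakayamaAlgebra k n t ns ls)
      (PathAlgebraRel k (linQuiver n)
        {p | ∃ i : Fin t, 3 ≤ ls i ∧ p = linPath n (ns i) (ls i)}) := by
  exact NakDer.main k n t ns ls h
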